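/- arXiv:1802.10504 — 9 statements merged into one kernel-verified Lean document; each statement's English description precedes it below -/
import Mathlib

section
/- Let g ≥ 2. The abelianization of Γ(2) is isomorphic to (ℤ/2ℤ)^{2g²−g} × (ℤ/4ℤ)^{2g}; moreover, the principal congruence subgroup Γ(8) is contained in the commutator subgroup of Γ(2), so the abelianization map of Γ(2) factors through Γ(2)/Γ(8). -/
set_option synthInstance.maxHeartbeats 400000
set_option maxHeartbeats 1000000

noncomputable section

namespace PaperSp

variable {l R S : Type} [DecidableEq l] [Fintype l] [CommRing R] [CommRing S]

lemma map_J (f : R →+* S) : (Matrix.J l R).map f = Matrix.J l S := by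
  ext i j
  cases i <;> cases j <;>
    simp [Matrix.J, Matrix.map_apply, Matrix.one_apply, apply_ite f]

lemma mem_map (f : R →+* S) {A : Matrix (l ⊕ l) (l ⊕ l) R}
    (hA : A ∈ Matrix.symplecticGroup l R) : A.map f ∈ Matrix.symplecticGroup l S := by
  rw [SymplecticGroup.mem_iff] at hA ⊢
  have h2 := congrArg (fun M => M.map f) hA
  simp only [Matrix.map_mul, map_J] at h2
  rwa [Matrix.transpose_map] at h2

/-- Entrywise reduction along a ring homomorphism, as a group homomorphism of
symplectic groups. -/
def spMap (f : R →+* S) :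
    Matrix.symplecticGroup l R →* Matrix.symplecticGroup l S where
  toFun A := ⟨A.1.map f, mem_map f A.2⟩
  map_one' := Subtype.ext (Matrix.map_one f f.map_zero f.map_one)
  map_mul' A B := Subtype.ext (by simp [Matrix.map_mul])

/-- `Γ(2ⁿ)`, the principal congruence subgroup of level `2ⁿ` in `Sp_{2g}(ℤ₂)`: the kernel
of the entrywise reduction map `Sp_{2g}(ℤ₂) → Sp_{2g}(ℤ/2ⁿℤ)`. -/
def Gamma (g n : ℕ) : Subgroup ↥(Matrix.symplecticGroup (Fin g) ℤ_[2]) :=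
  (spMap (PadicInt.toZModPow n)).ker

section block_matrices

variable {n : Type} [DecidableEq n] [Fintype n]

lemma fromBlocks_mem_symplecticGroup_iff {a b c d : Matrix n n R} :
    Matrix.fromBlocks a b c d ∈ Matrix.symplecticGroup n R ↔
      (a * b.transpose = b * a.transpose ∧ c * d.transpose = d * c.transpose ∧
        a * d.transpose - b * c.transpose = 1 ∧ d * a.transpose - c * b.transpose = 1) := by
  rw [SymplecticGroup.mem_iff, Matrix.J, Matrix.fromBlocks_transpose,
    Matrix.fromBlocks_multiply, Matrix.fromBlocks_multiply, Matrix.fromBlocks_inj]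
  simp only [Matrix.mul_zero, zero_add, Matrix.mul_one, Matrix.mul_neg, Matrix.neg_mul, add_zero]
  constructor
  · rintro ⟨h1, h2, h3, h4⟩
    refine ⟨?_, ?_, ?_, ?_⟩
    · rw [← sub_eq_zero, ← neg_eq_zero, ← h1]; abel
    · rw [← sub_eq_zero, ← neg_eq_zero, ← h4]; abel
    · rw [← neg_inj, ← h2]; abel
    · rw [← h3]; abel
  · rintro ⟨h1, h2, h3, h4⟩
    refine ⟨?_, ?_, ?_, ?_⟩
    · rw [h1]; abel
    · rw [← h3]; abel
    · rw [← h4]; abel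
    · rw [h2]; abel

/-- The symplectic transvection block matrix with upper right block `b`. -/
def upper (b : Matrix n n R) : Matrix (n ⊕ n) (n ⊕ n) R := Matrix.fromBlocks 1 b 0 1

/-- The symplectic transvection block matrix with lower left block `c`. -/
def lower (c : Matrix n n R) : Matrix (n ⊕ n) (n ⊕ n) R := Matrix.fromBlocks 1 0 c 1

lemma upper_mem {b : Matrix n n R} (hb : b.IsSymm) :
    upper b ∈ Matrix.symplecticGroup n R := by
  simp [upper, fromBlocks_mem_symplecticGroup_iff, hb.eq]

lemma lower_mem {c : Matrix n n R} (hc : c.IsSymm) :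
    lower c ∈ Matrix.symplecticGroup n R := by
  simp [lower, fromBlocks_mem_symplecticGroup_iff, hc.eq]

lemma upper_add (b b' : Matrix n n R) : upper (b + b') = upper b * upper b' := by
  simp [upper, Matrix.fromBlocks_multiply, add_comm]

lemma lower_add (c c' : Matrix n n R) : lower (c + c') = lower c * lower c' := by
  simp [lower, Matrix.fromBlocks_multiply]

lemma upper_zero : upper (0 : Matrix n n R) = 1 := Matrix.fromBlocks_one

lemma lower_zero : lower (0 : Matrix n n R) = 1 := Matrix.fromBlocks_one

lemma upper_mul_upper_neg (b : Matrix n n R) : upper b * upper (-b) = 1 := by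
  rw [← upper_add, add_neg_cancel, upper_zero]

lemma lower_mul_lower_neg (c : Matrix n n R) : lower c * lower (-c) = 1 := by
  rw [← lower_add, add_neg_cancel, lower_zero]

/-- The block diagonal matrix with blocks `a` and `d`. -/
def levi (a d : Matrix n n R) : Matrix (n ⊕ n) (n ⊕ n) R := Matrix.fromBlocks a 0 0 d

lemma levi_mul (a d a' d' : Matrix n n R) : levi a d * levi a' d' = levi (a * a') (d * d') := by
  simp [levi, Matrix.fromBlocks_multiply]

lemma levi_mem {a d : Matrix n n R} (h : a * d.transpose = 1) :
    levi a d ∈ Matrix.symplecticGroup n R := by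
  have h2 : d * a.transpose = 1 := by
    have := congrArg Matrix.transpose h
    simpa using this
  simp [levi, fromBlocks_mem_symplecticGroup_iff, h, h2]

lemma levi_conj_upper {a d : Matrix n n R} (h : a * d.transpose = 1) (b : Matrix n n R) :
    levi a d * upper b * levi d.transpose a.transpose * upper (-b) =
      upper (a * b * a.transpose - b) := by
  have h2 : d * a.transpose = 1 := by
    have := congrArg Matrix.transpose h
    simpa using this
  simp [levi, upper, Matrix.fromBlocks_multiply, h, h2, sub_eq_add_neg, add_comm]

lemma levi_conj_lower {a d : Matrix n n R} (h : a * d.transpose = 1) (c : Matrix n n R) :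
    levi a d * lower c * levi d.transpose a.transpose * lower (-c) =
      lower (d * c * d.transpose - c) := by
  have h2 : d * a.transpose = 1 := by
    have := congrArg Matrix.transpose h
    simpa using this
  simp [levi, lower, Matrix.fromBlocks_multiply, h, h2, sub_eq_add_neg]

lemma lower_upper_commutator (b c : Matrix n n R) :
    lower c * upper b * lower (-c) * upper (-b) =
      Matrix.fromBlocks (1 - b * c) (b * c * b) (-(c * b * c)) (1 + c * b + c * b * c * b) := by
  simp only [lower, upper, Matrix.fromBlocks_multiply, Matrix.fromBlocks_inj]
  refine ⟨?_, ?_, ?_, ?_⟩ <;> noncomm_ring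

/-- Gauss decomposition of a symplectic matrix whose upper left block is invertible. -/
lemma fromBlocks_eq_lower_mul_levi_mul_upper {a b c d a' : Matrix n n R}
    (h : Matrix.fromBlocks a b c d ∈ Matrix.symplecticGroup n R) (ha : a * a' = 1) :
    (a' * b).IsSymm ∧ (c * a').IsSymm ∧
      Matrix.fromBlocks a b c d = lower (c * a') * levi a a'.transpose * upper (a' * b) := by
  have ha' : a' * a = 1 := mul_eq_one_comm.mp ha
  have hT : a.transpose * a'.transpose = 1 := by
    rw [← Matrix.transpose_mul, ha', Matrix.transpose_one]
  have hT' : a'.transpose * a.transpose = 1 := by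
    rw [← Matrix.transpose_mul, ha, Matrix.transpose_one]
  have h' := SymplecticGroup.transpose_mem h
  rw [Matrix.fromBlocks_transpose, fromBlocks_mem_symplecticGroup_iff] at h'
  rw [fromBlocks_mem_symplecticGroup_iff] at h
  obtain ⟨h1, h2, h3, h4⟩ := h
  obtain ⟨k1, k2, k3, k4⟩ := h'
  simp only [Matrix.transpose_transpose] at k1 k2 k3 k4
  have s1 : (a' * b).IsSymm := by
    rw [Matrix.IsSymm, Matrix.transpose_mul]
    calc b.transpose * a'.transpose = (a' * a) * b.transpose * a'.transpose := by
          rw [ha', one_mul]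
      _ = a' * (a * b.transpose) * a'.transpose := by simp only [Matrix.mul_assoc]
      _ = a' * b * (a.transpose * a'.transpose) := by rw [h1]; simp only [Matrix.mul_assoc]
      _ = a' * b := by rw [hT, mul_one]
  have s2 : (c * a').IsSymm := by
    rw [Matrix.IsSymm, Matrix.transpose_mul]
    calc a'.transpose * c.transpose = a'.transpose * c.transpose * (a * a') := by
          rw [ha, mul_one]
      _ = a'.transpose * (c.transpose * a) * a' := by simp only [Matrix.mul_assoc]
      _ = (a'.transpose * a.transpose) * c * a' := by
          rw [← k1]; simp only [Matrix.mul_assoc]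
      _ = c * a' := by rw [hT', one_mul]
  refine ⟨s1, s2, ?_⟩
  simp only [lower, levi, upper, Matrix.fromBlocks_multiply, Matrix.fromBlocks_inj]
  have e1 : a * (a' * b) = b := by rw [← Matrix.mul_assoc, ha, one_mul]
  have e2 : c * a' * a = c := by rw [Matrix.mul_assoc, ha', mul_one]
  refine ⟨by simp, by simp [e1], by simp [e2], ?_⟩
  simp only [Matrix.mul_zero, add_zero, zero_add, mul_one, one_mul, e2]
  have k5 : a.transpose * (d - c * (a' * b)) = 1 := by
    rw [Matrix.mul_sub, ← Matrix.mul_assoc, k1, Matrix.mul_assoc, e1, k3]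
  calc d = c * (a' * b) + a'.transpose * a.transpose * (d - c * (a' * b)) := by
        rw [hT', one_mul]; abel
    _ = _ := by rw [Matrix.mul_assoc, k5, mul_one]

lemma sum_single_closure {P : Matrix n n R → Prop} [LinearOrder n] (h0 : P 0)
    (hadd : ∀ x y, P x → P y → P (x + y)) {b : Matrix n n R} (hb : b.IsSymm)
    (hdiag : ∀ i, P (Matrix.single i i (b i i)))
    (hoff : ∀ i j, i ≠ j → P (Matrix.single i j (b i j) + Matrix.single j i (b i j))) : P b := by
  have hsum : ∀ (s : Finset n) (f : n → Matrix n n R), (∀ i, P (f i)) → P (∑ i ∈ s, f i) := by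
    intro s f hf
    exact Finset.sum_induction f P hadd h0 fun i _ => hf i
  set T : Matrix n n R := Matrix.of fun i j => if i < j then b i j else 0 with hT
  have e : b = ∑ i, ∑ j, (Matrix.single i j (T i j) + Matrix.single j i (T i j)) +
      ∑ i, Matrix.single i i (b i i) := by
    have e1 : T = ∑ i, ∑ j, Matrix.single i j (T i j) := Matrix.matrix_eq_sum_single T
    have e2 : T.transpose = ∑ i, ∑ j, Matrix.single j i (T i j) := by
      conv_lhs => rw [e1]
      simp [Matrix.transpose_sum]
    have e3 : Matrix.diagonal (fun i => b i i) = ∑ i, Matrix.single i i (b i i) := by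
      exact (Matrix.sum_single_eq_diagonal _).symm
    simp only [Finset.sum_add_distrib]
    rw [← e1, ← e2, ← e3]
    ext i j
    rcases lt_trichotomy i j with h | h | h
    · simp [hT, h, h.not_gt, h.ne]
    · subst h; simp [hT]
    · simp [hT, h, h.not_gt, h.ne', hb.apply]
  rw [e]
  refine hadd _ _ (hsum _ _ fun i => hsum _ _ fun j => ?_) (hsum _ _ hdiag)
  by_cases h : i < j
  · simpa [hT, h] using hoff i j h.ne
  · simpa [hT, h] using h0

/-- A property of symmetric matrices that is stable under sums and holds for the differences
`e (2S) eᵀ - 2S`, with `e` an elementary matrix congruent to `1` modulo `2`, holds for the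
symmetric matrices divisible by `4` whose diagonal is divisible by `8`. -/
lemma symm_induction {P : Matrix n n R → Prop} [LinearOrder n] [Nontrivial n] (h0 : P 0)
    (hadd : ∀ x y, P x → P y → P (x + y))
    (hP : ∀ i j : n, i ≠ j → ∀ S : Matrix n n R, S.IsSymm →
      P ((1 + Matrix.single i j 2) * ((2 : R) • S) * (1 + Matrix.single j i 2) - (2 : R) • S))
    {b : Matrix n n R} (hb : b.IsSymm) (h4 : ∀ i j, (4 : R) ∣ b i j)
    (h8 : ∀ i, (8 : R) ∣ b i i) : P b := by
  have hlong : ∀ i (t : R), P (Matrix.single i i (8 * t)) := by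
    intro i t
    obtain ⟨j, hj⟩ := exists_ne i
    convert hP i j hj.symm (Matrix.single i j t + Matrix.single j i t)
      (by simp [Matrix.IsSymm, add_comm]) using 1
    simp [Matrix.mul_add, Matrix.add_mul, hj, hj.symm]
    ext k l
    simp [Matrix.single_apply]
    split_ifs <;> simp_all <;> ring
  have hshort : ∀ i j, i ≠ j → ∀ t : R,
      P (Matrix.single i j (4 * t) + Matrix.single j i (4 * t)) := by
    intro i j hij t
    convert hadd _ _ (hP i j hij (Matrix.single j j t) (by simp [Matrix.IsSymm]))
      (hlong i (-t)) using 1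
    simp [Matrix.mul_add, Matrix.add_mul]
    ext k l
    simp [Matrix.single_apply]
    split_ifs <;> simp_all <;> ring
  refine sum_single_closure h0 hadd hb (fun i => ?_) fun i j hij => ?_
  · obtain ⟨t, ht⟩ := h8 i
    rw [ht]; exact hlong i t
  · obtain ⟨t, ht⟩ := h4 i j
    rw [ht]; exact hshort i j hij t

end block_matrices

section divisibility

lemma toZMod_eq_zero_iff (x : ℤ_[2]) : PadicInt.toZMod x = 0 ↔ (2 : ℤ_[2]) ∣ x := by
  rw [← RingHom.mem_ker, PadicInt.ker_toZMod, PadicInt.maximalIdeal_eq_span_p,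
    Ideal.mem_span_singleton]
  norm_num

lemma toZModPow_eq_zero_iff (n : ℕ) (x : ℤ_[2]) :
    PadicInt.toZModPow n x = 0 ↔ (2 : ℤ_[2]) ^ n ∣ x := by
  rw [← RingHom.mem_ker, PadicInt.ker_toZModPow, Ideal.mem_span_singleton]
  norm_num

lemma exists_eq_smul_of_forall_dvd {m n : Type} {k : R} {x : Matrix m n R}
    (h : ∀ i j, k ∣ x i j) : ∃ y : Matrix m n R, x = k • y := by
  choose y hy using h
  exact ⟨Matrix.of y, by ext i j; simp [hy i j]⟩

lemma dvd_mul_apply_left {m n o : Type} [Fintype n] {k : R} {x : Matrix m n R}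
    (h : ∀ i j, k ∣ x i j) (y : Matrix n o R) (i : m) (j : o) : k ∣ (x * y) i j := by
  rw [Matrix.mul_apply]
  exact Finset.dvd_sum fun l _ => (h i l).mul_right _

lemma dvd_mul_apply_right {m n o : Type} [Fintype n] {k : R} (x : Matrix m n R)
    {y : Matrix n o R} (h : ∀ i j, k ∣ y i j) (i : m) (j : o) : k ∣ (x * y) i j := by
  rw [Matrix.mul_apply]
  exact Finset.dvd_sum fun l _ => (h l j).mul_left _

lemma exists_mul_eq_one_of_dvd_sub_one {n : Type} [DecidableEq n] [Fintype n]
    {a : Matrix n n ℤ_[2]} (h : ∀ i j, (2 : ℤ_[2]) ∣ (a - 1) i j) :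
    ∃ a' : Matrix n n ℤ_[2], a * a' = 1 := by
  have h1 : a.map (PadicInt.toZMod (p := 2)) = 1 := by
    ext i j
    have := (toZMod_eq_zero_iff _).2 (h i j)
    rw [Matrix.sub_apply, map_sub, sub_eq_zero] at this
    rw [Matrix.map_apply, this]
    simp only [Matrix.one_apply]
    split_ifs
    · exact map_one _
    · exact map_zero _
  have h2 : PadicInt.toZMod a.det = 1 := by
    rw [RingHom.map_det, RingHom.mapMatrix_apply, h1, Matrix.det_one]
  have h3 : IsUnit a.det := by
    rw [← IsLocalRing.notMem_maximalIdeal, ← PadicInt.ker_toZMod, RingHom.mem_ker, h2]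
    exact one_ne_zero
  exact ⟨a⁻¹, Matrix.mul_nonsing_inv a h3⟩

end divisibility

section congruence_subgroups

variable {g : ℕ}

/-- The matrices underlying the elements of `Γ(2ⁿ)`. -/
def gammaMatrices (g n : ℕ) : Submonoid (Matrix (Fin g ⊕ Fin g) (Fin g ⊕ Fin g) ℤ_[2]) :=
  (Gamma g n).toSubmonoid.map (Matrix.symplecticGroup (Fin g) ℤ_[2]).subtype

/-- The matrices underlying the elements of the commutator subgroup of `Γ(2)`. -/
def commutatorMatrices (g : ℕ) : Submonoid (Matrix (Fin g ⊕ Fin g) (Fin g ⊕ Fin g) ℤ_[2]) :=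
  (⁅Gamma g 1, Gamma g 1⁆).toSubmonoid.map (Matrix.symplecticGroup (Fin g) ℤ_[2]).subtype

lemma mem_Gamma_iff {n : ℕ} {A : Matrix.symplecticGroup (Fin g) ℤ_[2]} :
    A ∈ Gamma g n ↔ ∀ i j, (2 : ℤ_[2]) ^ n ∣ (A.1 - 1) i j := by
  rw [Gamma, MonoidHom.mem_ker, Subtype.ext_iff]
  simp only [← toZModPow_eq_zero_iff, Matrix.sub_apply, map_sub, sub_eq_zero]
  rw [← Matrix.ext_iff]
  refine forall_congr' fun i => forall_congr' fun j => ?_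
  have : PadicInt.toZModPow n ((1 : Matrix (Fin g ⊕ Fin g) (Fin g ⊕ Fin g) ℤ_[2]) i j) =
      (1 : Matrix (Fin g ⊕ Fin g) (Fin g ⊕ Fin g) (ZMod (2 ^ n))) i j := by
    simp only [Matrix.one_apply]
    split_ifs <;> simp
  rw [this]
  rfl

lemma mem_commutatorMatrices {X : Matrix.symplecticGroup (Fin g) ℤ_[2]} :
    X.1 ∈ commutatorMatrices g ↔ X ∈ ⁅Gamma g 1, Gamma g 1⁆ := by
  constructor
  · rintro ⟨x, hx, h⟩
    rwa [← show x = X from Subtype.ext h]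
  · intro h
    exact ⟨X, h, rfl⟩

lemma commutatorMatrices_le_symplecticGroup :
    commutatorMatrices g ≤ Matrix.symplecticGroup (Fin g) ℤ_[2] := by
  rintro _ ⟨x, -, rfl⟩
  exact x.2

lemma fromBlocks_mem_gammaMatrices {n : ℕ} {a b c d : Matrix (Fin g) (Fin g) ℤ_[2]}
    (h : Matrix.fromBlocks a b c d ∈ Matrix.symplecticGroup (Fin g) ℤ_[2])
    (ha : ∀ i j, (2 : ℤ_[2]) ^ n ∣ (a - 1) i j) (hb : ∀ i j, (2 : ℤ_[2]) ^ n ∣ b i j)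
    (hc : ∀ i j, (2 : ℤ_[2]) ^ n ∣ c i j) (hd : ∀ i j, (2 : ℤ_[2]) ^ n ∣ (d - 1) i j) :
    Matrix.fromBlocks a b c d ∈ gammaMatrices g n := by
  refine ⟨⟨_, h⟩, ?_, rfl⟩
  refine mem_Gamma_iff.2 ?_
  rintro (i | i) (j | j)
  · simpa [Matrix.one_apply] using ha i j
  · simpa [Matrix.one_apply] using hb i j
  · simpa [Matrix.one_apply] using hc i j
  · simpa [Matrix.one_apply] using hd i j

lemma upper_mem_gammaMatrices {n : ℕ} {b : Matrix (Fin g) (Fin g) ℤ_[2]} (hb : b.IsSymm)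
    (h : ∀ i j, (2 : ℤ_[2]) ^ n ∣ b i j) : upper b ∈ gammaMatrices g n :=
  fromBlocks_mem_gammaMatrices (upper_mem hb) (by simp) h (by simp) (by simp)

lemma lower_mem_gammaMatrices {n : ℕ} {c : Matrix (Fin g) (Fin g) ℤ_[2]} (hc : c.IsSymm)
    (h : ∀ i j, (2 : ℤ_[2]) ^ n ∣ c i j) : lower c ∈ gammaMatrices g n :=
  fromBlocks_mem_gammaMatrices (lower_mem hc) (by simp) (by simp) h (by simp)

lemma commutator_mem_commutatorMatrices
    {X Y X' Y' : Matrix (Fin g ⊕ Fin g) (Fin g ⊕ Fin g) ℤ_[2]}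
    (hX : X ∈ gammaMatrices g 1) (hY : Y ∈ gammaMatrices g 1) (hX' : X * X' = 1)
    (hY' : Y * Y' = 1) : X * Y * X' * Y' ∈ commutatorMatrices g := by
  obtain ⟨x, hx, rfl⟩ := hX
  obtain ⟨y, hy, rfl⟩ := hY
  have key : ∀ (x : Matrix.symplecticGroup (Fin g) ℤ_[2]) (X' : Matrix _ _ ℤ_[2]),
      x.1 * X' = 1 → X' = (x⁻¹).1 := by
    intro x X' h
    have h2 : (x⁻¹).1 * x.1 = 1 := congrArg Subtype.val (inv_mul_cancel x)
    rw [← one_mul X', ← h2, mul_assoc, h, mul_one]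
  rw [key x X' hX', key y Y' hY']
  exact ⟨x * y * x⁻¹ * y⁻¹, Subgroup.commutator_mem_commutator hx hy, rfl⟩

lemma mem_commutatorMatrices_of_mul_mul_mem
    {X Y Z : Matrix (Fin g ⊕ Fin g) (Fin g ⊕ Fin g) ℤ_[2]}
    (hY : Y ∈ Matrix.symplecticGroup (Fin g) ℤ_[2]) (hX : X ∈ commutatorMatrices g)
    (hZ : Z ∈ commutatorMatrices g) (h : X * Y * Z ∈ commutatorMatrices g) :
    Y ∈ commutatorMatrices g := by
  obtain ⟨x, hx, rfl⟩ := hX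
  obtain ⟨z, hz, rfl⟩ := hZ
  lift Y to Matrix.symplecticGroup (Fin g) ℤ_[2] using hY with y
  rw [mem_commutatorMatrices]
  have h' : x * y * z ∈ ⁅Gamma g 1, Gamma g 1⁆ := mem_commutatorMatrices.1 h
  rwa [Subgroup.mul_mem_cancel_right _ hz, Subgroup.mul_mem_cancel_left _ hx] at h'

lemma dvd_single_apply {i j : Fin g} {k t : ℤ_[2]} (h : k ∣ t) (x y : Fin g) :
    k ∣ Matrix.single i j t x y := by
  rw [Matrix.single_apply]
  split_ifs
  · exact h
  · exact dvd_zero k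

lemma upper_lower_mem_commutatorMatrices (hg : 2 ≤ g) {b : Matrix (Fin g) (Fin g) ℤ_[2]}
    (hb : b.IsSymm) (h4 : ∀ i j, (4 : ℤ_[2]) ∣ b i j) (h8 : ∀ i, (8 : ℤ_[2]) ∣ b i i) :
    upper b ∈ commutatorMatrices g ∧ lower b ∈ commutatorMatrices g := by
  have : Nontrivial (Fin g) := Fin.nontrivial_iff_two_le.2 hg
  have hinv : ∀ i j : Fin g, i ≠ j → (1 + Matrix.single i j (2 : ℤ_[2])) *
      (1 + Matrix.single i j (-2)) = 1 := by
    intro i j hij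
    rw [mul_add, mul_one, add_mul, one_mul, Matrix.single_mul_single_of_ne _ _ _ _ hij.symm,
      add_zero, add_assoc, ← Matrix.single_add]
    simp
  have hmem : ∀ i j : Fin g, i ≠ j → ∀ s t : ℤ_[2], 2 ∣ s → 2 ∣ t →
      (1 + Matrix.single i j s) * (1 + Matrix.single j i t).transpose = 1 →
      levi (1 + Matrix.single i j s) (1 + Matrix.single j i t) ∈ gammaMatrices g 1 := by
    intro i j hij s t hs ht h
    refine fromBlocks_mem_gammaMatrices (levi_mem h) ?_ (by simp) (by simp) ?_
    · simpa using fun x y => dvd_single_apply hs x y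
    · simpa using fun x y => dvd_single_apply ht x y
  refine ⟨symm_induction (P := fun b => upper b ∈ commutatorMatrices g) ?_ ?_ ?_ hb h4 h8,
    symm_induction (P := fun b => lower b ∈ commutatorMatrices g) ?_ ?_ ?_ hb h4 h8⟩
  · rw [upper_zero]; exact one_mem _
  · intro x y hx hy
    rw [upper_add]; exact mul_mem hx hy
  · intro i j hij S hS
    have h : (1 + Matrix.single i j (2 : ℤ_[2])) *
        (1 + Matrix.single j i (-2 : ℤ_[2])).transpose = 1 := by
      simpa using hinv i j hij
    have h' := levi_conj_upper h ((2 : ℤ_[2]) • S)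
    simp only [Matrix.transpose_add, Matrix.transpose_one, Matrix.transpose_single] at h h'
    rw [← h']
    refine commutator_mem_commutatorMatrices
      (hmem i j hij _ _ (by simp) (by simp) (by simpa using h))
      (upper_mem_gammaMatrices (hS.smul _) (by simp)) ?_ (upper_mul_upper_neg _)
    rw [levi_mul, h]
    have h2 := hinv j i hij.symm
    rw [mul_eq_one_comm.mp h2]
    exact Matrix.fromBlocks_one
  · rw [lower_zero]; exact one_mem _
  · intro x y hx hy
    rw [lower_add]; exact mul_mem hx hy
  · intro i j hij S hS
    have h : (1 + Matrix.single j i (-2 : ℤ_[2])) *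
        (1 + Matrix.single i j (2 : ℤ_[2])).transpose = 1 := by
      simpa using mul_eq_one_comm.mp (hinv j i hij.symm)
    have h' := levi_conj_lower h ((2 : ℤ_[2]) • S)
    simp only [Matrix.transpose_add, Matrix.transpose_one, Matrix.transpose_single] at h h'
    rw [← h']
    refine commutator_mem_commutatorMatrices
      (hmem j i hij.symm _ _ (by simp) (by simp) (by simpa using h))
      (lower_mem_gammaMatrices (hS.smul _) (by simp)) ?_ (lower_mul_lower_neg _)
    rw [levi_mul, h]
    have h2 := hinv i j hij
    rw [h2]
    exact Matrix.fromBlocks_one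

lemma upper_mem_commutatorMatrices (hg : 2 ≤ g) {b : Matrix (Fin g) (Fin g) ℤ_[2]}
    (hb : b.IsSymm) (h4 : ∀ i j, (4 : ℤ_[2]) ∣ b i j) (h8 : ∀ i, (8 : ℤ_[2]) ∣ b i i) :
    upper b ∈ commutatorMatrices g := (upper_lower_mem_commutatorMatrices hg hb h4 h8).1

lemma lower_mem_commutatorMatrices (hg : 2 ≤ g) {b : Matrix (Fin g) (Fin g) ℤ_[2]}
    (hb : b.IsSymm) (h4 : ∀ i j, (4 : ℤ_[2]) ∣ b i j) (h8 : ∀ i, (8 : ℤ_[2]) ∣ b i i) :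
    lower b ∈ commutatorMatrices g := (upper_lower_mem_commutatorMatrices hg hb h4 h8).2

lemma levi_one_sub_mem_commutatorMatrices (hg : 2 ≤ g)
    {b c d : Matrix (Fin g) (Fin g) ℤ_[2]} (hb : b.IsSymm) (hc : c.IsSymm)
    (h : (1 - ((2 : ℤ_[2]) • b) * ((2 : ℤ_[2]) • c)) * d.transpose = 1) :
    levi (1 - ((2 : ℤ_[2]) • b) * ((2 : ℤ_[2]) • c)) d ∈ commutatorMatrices g := by
  have hN := commutator_mem_commutatorMatrices
    (lower_mem_gammaMatrices (n := 1) (hc.smul (2 : ℤ_[2])) (by simp))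
    (upper_mem_gammaMatrices (n := 1) (hb.smul (2 : ℤ_[2])) (by simp))
    (lower_mul_lower_neg _) (upper_mul_upper_neg _)
  rw [lower_upper_commutator] at hN
  have hS := commutatorMatrices_le_symplecticGroup hN
  obtain ⟨s1, s2, e⟩ := fromBlocks_eq_lower_mul_levi_mul_upper hS h
  rw [e, Matrix.transpose_transpose] at hN
  have h8 : ∀ x y : Matrix (Fin g) (Fin g) ℤ_[2], ∀ i j, (8 : ℤ_[2]) ∣
      ((2 : ℤ_[2]) • x * ((2 : ℤ_[2]) • y) * ((2 : ℤ_[2]) • x)) i j := by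
    intro x y i j
    simp only [smul_mul_assoc, mul_smul_comm, smul_smul]
    exact ⟨(x * y * x) i j, by simp only [Matrix.smul_apply, smul_eq_mul]; ring⟩
  have h48 : (4 : ℤ_[2]) ∣ 8 := ⟨2, by norm_num⟩
  have d1 := dvd_mul_apply_right d.transpose (h8 b c)
  have d2 := dvd_mul_apply_left (x := -((2 : ℤ_[2]) • c * ((2 : ℤ_[2]) • b) *
    ((2 : ℤ_[2]) • c))) (fun i j => (dvd_neg.2 (h8 c b i j) : _)) d.transpose
  exact mem_commutatorMatrices_of_mul_mul_mem (levi_mem h)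
    (lower_mem_commutatorMatrices hg s2 (fun i j => h48.trans (d2 i j)) fun i => d2 i i)
    (upper_mem_commutatorMatrices hg s1 (fun i j => h48.trans (d1 i j)) fun i => d1 i i) hN

lemma levi_row_mem_commutatorMatrices (hg : 2 ≤ g) (i : Fin g) (v : Fin g → ℤ_[2])
    {e d : Matrix (Fin g) (Fin g) ℤ_[2]}
    (he : e = 1 + (4 : ℤ_[2]) • Matrix.vecMulVec (Pi.single i 1) v)
    (h : e * d.transpose = 1) : levi e d ∈ commutatorMatrices g := by
  have e1 : e = 1 - ((2 : ℤ_[2]) • Matrix.single i i (-1)) * ((2 : ℤ_[2]) •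
      (Matrix.vecMulVec (Pi.single i 1) v + Matrix.vecMulVec v (Pi.single i 1) -
        Matrix.single i i (v i))) := by
    rw [he]
    ext k l
    by_cases hk : k = i
    · subst hk
      by_cases hl : l = k
      · subst hl
        simp [Matrix.vecMulVec_apply]; ring
      · simp [Matrix.vecMulVec_apply, hl, Ne.symm hl]; ring
    · simp [Matrix.vecMulVec_apply, hk]
  rw [e1] at h ⊢
  refine levi_one_sub_mem_commutatorMatrices hg (by simp [Matrix.IsSymm]) ?_ h
  simp [Matrix.IsSymm, Matrix.transpose_vecMulVec, add_comm]

lemma levi_mem_commutatorMatrices (hg : 2 ≤ g) {a d : Matrix (Fin g) (Fin g) ℤ_[2]}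
    (h : a * d.transpose = 1) (h4 : ∀ i j, (4 : ℤ_[2]) ∣ (a - 1) i j) :
    levi a d ∈ commutatorMatrices g := by
  have key : ∀ (s : Finset (Fin g)) (a d : Matrix (Fin g) (Fin g) ℤ_[2]),
      a * d.transpose = 1 → (∀ i j, (4 : ℤ_[2]) ∣ (a - 1) i j) →
      (∀ i ∉ s, ∀ j, a i j = (1 : Matrix (Fin g) (Fin g) ℤ_[2]) i j) →
      levi a d ∈ commutatorMatrices g := by
    intro s
    induction s using Finset.induction_on with
    | empty =>
      intro a d h _ hs
      have ha : a = 1 := Matrix.ext fun i j => hs i (by simp) j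
      subst ha
      have hd : d = 1 := by simpa using h
      subst hd
      rw [show levi (1 : Matrix (Fin g) (Fin g) ℤ_[2]) 1 = 1 from Matrix.fromBlocks_one]
      exact one_mem _
    | insert i s _ ih =>
      intro a d h h4 hs
      set a₀ := a.updateRow i ((1 : Matrix (Fin g) (Fin g) ℤ_[2]) i) with ha₀
      have h4₀ : ∀ k j, (4 : ℤ_[2]) ∣ (a₀ - 1) k j := by
        intro k j
        by_cases hk : k = i
        · subst hk; simp [ha₀]
        · simpa [ha₀, hk] using h4 k j
      have h24 : (2 : ℤ_[2]) ∣ 4 := ⟨2, by norm_num⟩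
      obtain ⟨b, hb⟩ := exists_mul_eq_one_of_dvd_sub_one fun i j => h24.trans (h4₀ i j)
      have hb' : b * a₀ = 1 := mul_eq_one_comm.mp hb
      have hs₀ : levi a₀ b.transpose ∈ commutatorMatrices g := by
        refine ih _ _ (by simpa using hb) h4₀ fun k hk j => ?_
        by_cases hki : k = i
        · subst hki; simp [ha₀]
        · simpa [ha₀, hki] using hs k (by simp [hki, hk]) j
      choose u hu using fun j => h4 i j
      have e1 : a - a₀ = (4 : ℤ_[2]) • Matrix.vecMulVec (Pi.single i 1) u := by
        ext k j
        by_cases hk : k = i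
        · subst hk
          simpa [ha₀, Matrix.vecMulVec_apply] using hu j
        · simp [ha₀, hk, Matrix.vecMulVec_apply]
      have e2 : a * b = 1 + (4 : ℤ_[2]) • Matrix.vecMulVec (Pi.single i 1)
          (Matrix.vecMul u b) := by
        rw [← Matrix.vecMulVec_mul, ← smul_mul_assoc, ← e1, sub_mul, hb]
        abel
      have e3 : a * b * (d * a₀.transpose).transpose = 1 := by
        rw [Matrix.transpose_mul, Matrix.transpose_transpose, mul_assoc a b, ← mul_assoc b, hb',
          one_mul, h]
      have h5 := mul_mem (levi_row_mem_commutatorMatrices hg i _ e2 e3) hs₀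
      rwa [levi_mul, mul_assoc, hb', mul_one, mul_assoc d, ← Matrix.transpose_mul, hb',
        Matrix.transpose_one, mul_one] at h5
  exact key Finset.univ a d h h4 (by simp)

/-- Igusa's group `Γ(4,8)` is contained in the commutator subgroup of `Γ(2)`. -/
lemma fromBlocks_mem_commutatorMatrices (hg : 2 ≤ g)
    {a b c d : Matrix (Fin g) (Fin g) ℤ_[2]}
    (h : Matrix.fromBlocks a b c d ∈ Matrix.symplecticGroup (Fin g) ℤ_[2])
    (ha : ∀ i j, (4 : ℤ_[2]) ∣ (a - 1) i j) (hb : ∀ i j, (4 : ℤ_[2]) ∣ b i j)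
    (hb' : ∀ i, (8 : ℤ_[2]) ∣ b i i) (hc : ∀ i j, (4 : ℤ_[2]) ∣ c i j)
    (hc' : ∀ i, (8 : ℤ_[2]) ∣ c i i) :
    Matrix.fromBlocks a b c d ∈ commutatorMatrices g := by
  have h24 : (2 : ℤ_[2]) ∣ 4 := ⟨2, by norm_num⟩
  obtain ⟨a', h1⟩ := exists_mul_eq_one_of_dvd_sub_one fun i j => h24.trans (ha i j)
  have h2 : a' * a = 1 := mul_eq_one_comm.mp h1
  obtain ⟨s1, s2, e⟩ := fromBlocks_eq_lower_mul_levi_mul_upper h h1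
  obtain ⟨m, hm⟩ := exists_eq_smul_of_forall_dvd ha
  obtain ⟨q, hq⟩ := exists_eq_smul_of_forall_dvd hb
  obtain ⟨r, hr⟩ := exists_eq_smul_of_forall_dvd hc
  have ea : a = 1 + (4 : ℤ_[2]) • m := by rw [← hm]; abel
  have ea1 : a' = 1 - (4 : ℤ_[2]) • (a' * m) := by
    rw [← mul_smul_comm, ← hm, mul_sub, h2, mul_one]; abel
  have ea2 : a' = 1 - (4 : ℤ_[2]) • (m * a') := by
    rw [← smul_mul_assoc, ← hm, sub_mul, h1, one_mul]; abel
  rw [e]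
  refine mul_mem (mul_mem ?_ ?_) ?_
  · refine lower_mem_commutatorMatrices hg s2 (dvd_mul_apply_left hc a') fun i => ?_
    have : c * a' = c - (8 : ℤ_[2]) • ((2 : ℤ_[2]) • (r * (m * a'))) := by
      rw [ea2, mul_sub, mul_one, ← ea2, hr]
      simp only [smul_mul_assoc, mul_smul_comm, smul_smul]
      norm_num
    rw [this, Matrix.sub_apply, Matrix.smul_apply (8 : ℤ_[2])]
    exact dvd_sub (hc' i) (dvd_mul_right _ _)
  · exact levi_mem_commutatorMatrices hg (by simpa using h1) ha
  · refine upper_mem_commutatorMatrices hg s1 (dvd_mul_apply_right a' hb) fun i => ?_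
    have : a' * b = b - (8 : ℤ_[2]) • ((2 : ℤ_[2]) • (a' * m * q)) := by
      rw [ea1, sub_mul, one_mul, ← ea1, hq]
      simp only [smul_mul_assoc, mul_smul_comm, smul_smul]
      norm_num
    rw [this, Matrix.sub_apply, Matrix.smul_apply (8 : ℤ_[2])]
    exact dvd_sub (hb' i) (dvd_mul_right _ _)

end congruence_subgroups

section abelianization_map

variable {g : ℕ}

lemma exists_mem_Gamma_of_mem_gammaMatrices {n : ℕ}
    {X : Matrix (Fin g ⊕ Fin g) (Fin g ⊕ Fin g) ℤ_[2]} (h : X ∈ gammaMatrices g n) :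
    ∃ A : ↥(Gamma g n), A.1.1 = X := by
  obtain ⟨x, hx, rfl⟩ := h
  exact ⟨⟨x, hx⟩, rfl⟩

lemma exists_eq_one_add_two_smul (A : ↥(Gamma g 1)) :
    ∃ M : Matrix (Fin g ⊕ Fin g) (Fin g ⊕ Fin g) ℤ_[2], A.1.1 = 1 + (2 : ℤ_[2]) • M := by
  obtain ⟨M, hM⟩ := exists_eq_smul_of_forall_dvd (mem_Gamma_iff.1 A.2)
  exact ⟨M, by rw [← pow_one (2 : ℤ_[2]), ← hM]; abel⟩

/-- The matrix `M` with `A = 1 + 2 M`. -/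
def deviation (A : ↥(Gamma g 1)) : Matrix (Fin g ⊕ Fin g) (Fin g ⊕ Fin g) ℤ_[2] :=
  (exists_eq_one_add_two_smul A).choose

lemma eq_one_add_deviation (A : ↥(Gamma g 1)) : A.1.1 = 1 + (2 : ℤ_[2]) • deviation A :=
  (exists_eq_one_add_two_smul A).choose_spec

lemma deviation_eq {A : ↥(Gamma g 1)} {M : Matrix (Fin g ⊕ Fin g) (Fin g ⊕ Fin g) ℤ_[2]}
    (h : A.1.1 = 1 + (2 : ℤ_[2]) • M) : deviation A = M := by
  rw [eq_one_add_deviation, add_right_inj] at h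
  exact smul_right_injective _ (two_ne_zero : (2 : ℤ_[2]) ≠ 0) h

lemma deviation_mul (A B : ↥(Gamma g 1)) :
    deviation (A * B) = deviation A + deviation B + (2 : ℤ_[2]) • (deviation A * deviation B) := by
  apply deviation_eq
  change A.1.1 * B.1.1 = _
  rw [eq_one_add_deviation A, eq_one_add_deviation B]
  simp only [add_mul, mul_add, one_mul, mul_one, smul_add, smul_mul_assoc, mul_smul_comm]
  abel

/-- The relations modulo `2` satisfied by the blocks of `M` when `1 + 2 M` is symplectic. -/
lemma deviation_relations (A : ↥(Gamma g 1)) (i j : Fin g) :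
    (2 : ℤ_[2]) ∣ deviation A (Sum.inl i) (Sum.inr j) - deviation A (Sum.inl j) (Sum.inr i) ∧
    (2 : ℤ_[2]) ∣ deviation A (Sum.inr i) (Sum.inl j) - deviation A (Sum.inr j) (Sum.inl i) ∧
    (2 : ℤ_[2]) ∣ deviation A (Sum.inl i) (Sum.inl j) + deviation A (Sum.inr j) (Sum.inr i) := by
  set M := deviation A with hM
  set p := M.toBlocks₁₁ with hp
  set q := M.toBlocks₁₂ with hq
  set r := M.toBlocks₂₁ with hr
  set s := M.toBlocks₂₂ with hs
  have e : Matrix.fromBlocks (1 + (2 : ℤ_[2]) • p) ((2 : ℤ_[2]) • q) ((2 : ℤ_[2]) • r)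
      (1 + (2 : ℤ_[2]) • s) = A.1.1 := by
    rw [eq_one_add_deviation A, ← hM, ← Matrix.fromBlocks_toBlocks M, ← Matrix.fromBlocks_one,
      Matrix.fromBlocks_smul, Matrix.fromBlocks_add]
    simp [hp, hq, hr, hs]
  have h := A.1.2
  rw [← e, fromBlocks_mem_symplecticGroup_iff] at h
  obtain ⟨h1, h2, h3, -⟩ := h
  have two : (2 : ℤ_[2]) ≠ 0 := two_ne_zero
  refine ⟨?_, ?_, ?_⟩
  · change (2 : ℤ_[2]) ∣ q i j - q j i
    have := congrFun (congrFun h1 j) i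
    simp [add_mul, mul_add] at this
    refine ⟨(q * p.transpose) j i - (p * q.transpose) j i, mul_left_cancel₀ two ?_⟩
    linear_combination this
  · change (2 : ℤ_[2]) ∣ r i j - r j i
    have := congrFun (congrFun h2 i) j
    simp [add_mul, mul_add] at this
    refine ⟨(s * r.transpose) i j - (r * s.transpose) i j, mul_left_cancel₀ two ?_⟩
    linear_combination this
  · change (2 : ℤ_[2]) ∣ p i j + s j i
    have := congrFun (congrFun h3 i) j
    simp [add_mul, mul_add] at this
    refine ⟨(q * r.transpose) i j - (p * s.transpose) i j, mul_left_cancel₀ two ?_⟩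
    linear_combination this

/-- The index set of the `ZMod 2`-coordinates: the entries of the upper left block, the entries
of the upper right block above the diagonal and the entries of the lower left block below the
diagonal. -/
abbrev LinearIndex (g : ℕ) : Type := (Fin g × Fin g) ⊕ {x : Fin g × Fin g // x.1 ≠ x.2}

/-- The integral lift of the `ZMod 2`-coordinates of the abelianization map. -/
def linearCoordinate (M : Matrix (Fin g ⊕ Fin g) (Fin g ⊕ Fin g) ℤ_[2]) : LinearIndex g → ℤ_[2]
  | Sum.inl x => M (Sum.inl x.1) (Sum.inl x.2)
  | Sum.inr x => if x.1.1 < x.1.2 then M (Sum.inl x.1.1) (Sum.inr x.1.2)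
      else M (Sum.inr x.1.1) (Sum.inl x.1.2)

/-- The integral lift of the `ZMod 4`-coordinates of the abelianization map. -/
def quadraticCoordinate (M : Matrix (Fin g ⊕ Fin g) (Fin g ⊕ Fin g) ℤ_[2]) :
    Fin g ⊕ Fin g → ℤ_[2]
  | Sum.inl i => M (Sum.inl i) (Sum.inr i) -
      2 * ∑ j, M (Sum.inl i) (Sum.inl j) * M (Sum.inl i) (Sum.inr j)
  | Sum.inr i => M (Sum.inr i) (Sum.inl i) -
      2 * ∑ j, M (Sum.inr i) (Sum.inl j) * M (Sum.inl j) (Sum.inl i)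

lemma linearCoordinate_mul (A B : ↥(Gamma g 1)) (k : LinearIndex g) :
    (2 : ℤ_[2]) ∣ linearCoordinate (deviation (A * B)) k -
      (linearCoordinate (deviation A) k + linearCoordinate (deviation B) k) := by
  rw [deviation_mul]
  rcases k with x | x
  · simp [linearCoordinate]
  · simp only [linearCoordinate]
    split_ifs <;> simp

lemma four_dvd_of_polarization {ι : Type} [Fintype ι] {p q p' q' z X Y : ι → R}
    (h : ∀ j, 2 ∣ z j - (p j * q' j + p' j * q j)) :
    (4 : R) ∣ 2 * ∑ j, z j - 2 * ∑ j, (p j + p' j + 2 * X j) * (q j + q' j + 2 * Y j) +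
      2 * ∑ j, p j * q j + 2 * ∑ j, p' j * q' j := by
  have h2 : (2 : R) ∣ ∑ j, (z j - (p j + p' j + 2 * X j) * (q j + q' j + 2 * Y j) +
      p j * q j + p' j * q' j) := by
    refine Finset.dvd_sum fun j _ => ?_
    obtain ⟨t, ht⟩ := h j
    refine ⟨t - X j * (q j + q' j + 2 * Y j) - (p j + p' j) * Y j, ?_⟩
    linear_combination ht
  obtain ⟨t, ht⟩ := h2
  refine ⟨t, ?_⟩
  simp only [Finset.sum_add_distrib, Finset.sum_sub_distrib] at ht
  linear_combination 2 * ht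

lemma quadraticCoordinate_mul (A B : ↥(Gamma g 1)) (k : Fin g ⊕ Fin g) :
    (4 : ℤ_[2]) ∣ quadraticCoordinate (deviation (A * B)) k -
      (quadraticCoordinate (deviation A) k + quadraticCoordinate (deviation B) k) := by
  rw [deviation_mul]
  have rA := deviation_relations A
  have rB := deviation_relations B
  set M := deviation A
  set N := deviation B
  rcases k with i | i
  · have := four_dvd_of_polarization (p := fun j => M (Sum.inl i) (Sum.inl j))
      (q := fun j => M (Sum.inl i) (Sum.inr j)) (p' := fun j => N (Sum.inl i) (Sum.inl j))
      (q' := fun j => N (Sum.inl i) (Sum.inr j))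
      (z := fun j => M (Sum.inl i) (Sum.inl j) * N (Sum.inl j) (Sum.inr i) +
        M (Sum.inl i) (Sum.inr j) * N (Sum.inr j) (Sum.inr i))
      (X := fun j => (M * N) (Sum.inl i) (Sum.inl j))
      (Y := fun j => (M * N) (Sum.inl i) (Sum.inr j)) (fun j => ?_)
    · convert this using 1
      have e : (M * N) (Sum.inl i) (Sum.inr i) =
          ∑ j, (M (Sum.inl i) (Sum.inl j) * N (Sum.inl j) (Sum.inr i) +
            M (Sum.inl i) (Sum.inr j) * N (Sum.inr j) (Sum.inr i)) := by
        rw [Matrix.mul_apply, Fintype.sum_sum_type, Finset.sum_add_distrib]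
      simp only [quadraticCoordinate, Matrix.add_apply, Matrix.smul_apply, smul_eq_mul]
      rw [e]
      ring
    · obtain ⟨t, ht⟩ := (rB i j).1
      obtain ⟨u, hu⟩ := (rB i j).2.2
      refine ⟨-t * M (Sum.inl i) (Sum.inl j) + u * M (Sum.inl i) (Sum.inr j) -
        N (Sum.inl i) (Sum.inl j) * M (Sum.inl i) (Sum.inr j), ?_⟩
      linear_combination -M (Sum.inl i) (Sum.inl j) * ht + M (Sum.inl i) (Sum.inr j) * hu
  · have := four_dvd_of_polarization (p := fun j => M (Sum.inr i) (Sum.inl j))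
      (q := fun j => M (Sum.inl j) (Sum.inl i)) (p' := fun j => N (Sum.inr i) (Sum.inl j))
      (q' := fun j => N (Sum.inl j) (Sum.inl i))
      (z := fun j => M (Sum.inr i) (Sum.inl j) * N (Sum.inl j) (Sum.inl i) +
        M (Sum.inr i) (Sum.inr j) * N (Sum.inr j) (Sum.inl i))
      (X := fun j => (M * N) (Sum.inr i) (Sum.inl j))
      (Y := fun j => (M * N) (Sum.inl j) (Sum.inl i)) (fun j => ?_)
    · convert this using 1
      have e : (M * N) (Sum.inr i) (Sum.inl i) =
          ∑ j, (M (Sum.inr i) (Sum.inl j) * N (Sum.inl j) (Sum.inl i) +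
            M (Sum.inr i) (Sum.inr j) * N (Sum.inr j) (Sum.inl i)) := by
        rw [Matrix.mul_apply, Fintype.sum_sum_type, Finset.sum_add_distrib]
      simp only [quadraticCoordinate, Matrix.add_apply, Matrix.smul_apply, smul_eq_mul]
      rw [e]
      ring
    · obtain ⟨t, ht⟩ := (rB i j).2.1
      obtain ⟨u, hu⟩ := (rA j i).2.2
      refine ⟨-t * M (Sum.inr i) (Sum.inr j) + u * N (Sum.inr i) (Sum.inl j) -
        N (Sum.inr i) (Sum.inl j) * M (Sum.inl j) (Sum.inl i), ?_⟩
      linear_combination -M (Sum.inr i) (Sum.inr j) * ht + N (Sum.inr i) (Sum.inl j) * hu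

/-- The explicit homomorphism from `Γ(2)` onto its abelianization. -/
def abelianizationMap (g : ℕ) : ↥(Gamma g 1) →*
    Multiplicative ((LinearIndex g → ZMod 2) × (Fin g ⊕ Fin g → ZMod (2 ^ 2))) :=
  MonoidHom.mk' (fun A => Multiplicative.ofAdd
    (fun k => PadicInt.toZMod (linearCoordinate (deviation A) k),
      fun k => PadicInt.toZModPow 2 (quadraticCoordinate (deviation A) k))) (by
    intro A B
    rw [← ofAdd_add, Prod.mk_add_mk]
    congr 2
    · funext k
      have := (toZMod_eq_zero_iff _).2 (linearCoordinate_mul A B k)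
      rwa [map_sub, sub_eq_zero, map_add] at this
    · funext k
      have h4 : (4 : ℤ_[2]) = 2 ^ 2 := by norm_num
      have := (toZModPow_eq_zero_iff 2 _).2 (h4 ▸ quadraticCoordinate_mul A B k)
      rwa [map_sub, sub_eq_zero, map_add] at this)

lemma abelianizationMap_apply {A : ↥(Gamma g 1)}
    {M : Matrix (Fin g ⊕ Fin g) (Fin g ⊕ Fin g) ℤ_[2]} (h : A.1.1 = 1 + (2 : ℤ_[2]) • M) :
    abelianizationMap g A = Multiplicative.ofAdd
      (fun k => PadicInt.toZMod (linearCoordinate M k),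
        fun k => PadicInt.toZModPow 2 (quadraticCoordinate M k)) := by
  rw [← deviation_eq h]
  rfl

lemma mem_ker_abelianizationMap_iff {A : ↥(Gamma g 1)} : A ∈ (abelianizationMap g).ker ↔
    (∀ k, (2 : ℤ_[2]) ∣ linearCoordinate (deviation A) k) ∧
      ∀ k, (4 : ℤ_[2]) ∣ quadraticCoordinate (deviation A) k := by
  rw [MonoidHom.mem_ker, abelianizationMap_apply (eq_one_add_deviation A), ofAdd_eq_one,
    Prod.mk_eq_zero, funext_iff, funext_iff]
  have h4 : (4 : ℤ_[2]) = 2 ^ 2 := by norm_num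
  simp only [h4, ← toZMod_eq_zero_iff, ← toZModPow_eq_zero_iff, Pi.zero_apply]

lemma coe_mem_commutatorMatrices_of_mem_ker (hg : 2 ≤ g) {A : ↥(Gamma g 1)}
    (h : A ∈ (abelianizationMap g).ker) : A.1.1 ∈ commutatorMatrices g := by
  obtain ⟨h2, h4⟩ := mem_ker_abelianizationMap_iff.1 h
  have rA := deviation_relations A
  have e := eq_one_add_deviation A
  set M := deviation A
  have hp : ∀ i j, (2 : ℤ_[2]) ∣ M (Sum.inl i) (Sum.inl j) := fun i j => h2 (Sum.inl (i, j))
  have h24 : (2 : ℤ_[2]) ∣ 4 := ⟨2, by norm_num⟩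
  have hq' : ∀ i, (4 : ℤ_[2]) ∣ M (Sum.inl i) (Sum.inr i) := by
    intro i
    have h22 : (4 : ℤ_[2]) = 2 * 2 := by norm_num
    refine (dvd_sub_left ?_).1 (h4 (Sum.inl i))
    rw [h22]
    exact mul_dvd_mul_left _ (Finset.dvd_sum fun j _ => (hp i j).mul_right _)
  have hr' : ∀ i, (4 : ℤ_[2]) ∣ M (Sum.inr i) (Sum.inl i) := by
    intro i
    have h22 : (4 : ℤ_[2]) = 2 * 2 := by norm_num
    refine (dvd_sub_left ?_).1 (h4 (Sum.inr i))
    rw [h22]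
    exact mul_dvd_mul_left _ (Finset.dvd_sum fun j _ => (hp j i).mul_left _)
  have hq : ∀ i j, (2 : ℤ_[2]) ∣ M (Sum.inl i) (Sum.inr j) := by
    have lt : ∀ i j, i < j → (2 : ℤ_[2]) ∣ M (Sum.inl i) (Sum.inr j) := fun i j hij => by
      simpa [linearCoordinate, hij] using h2 (Sum.inr ⟨(i, j), hij.ne⟩)
    intro i j
    rcases lt_trichotomy i j with hij | hij | hij
    · exact lt i j hij
    · subst hij; exact h24.trans (hq' i)
    · exact (dvd_iff_dvd_of_dvd_sub (rA i j).1).2 (lt j i hij)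
  have hr : ∀ i j, (2 : ℤ_[2]) ∣ M (Sum.inr i) (Sum.inl j) := by
    have gt : ∀ i j, j < i → (2 : ℤ_[2]) ∣ M (Sum.inr i) (Sum.inl j) := fun i j hij => by
      simpa [linearCoordinate, hij.not_gt] using h2 (Sum.inr ⟨(i, j), hij.ne'⟩)
    intro i j
    rcases lt_trichotomy j i with hij | hij | hij
    · exact gt i j hij
    · subst hij; exact h24.trans (hr' j)
    · exact (dvd_iff_dvd_of_dvd_sub (rA i j).2.1).2 (gt j i hij)
  have h22 : (4 : ℤ_[2]) = 2 * 2 := by norm_num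
  have h248 : (8 : ℤ_[2]) = 2 * 4 := by norm_num
  have hS := A.1.2
  rw [← Matrix.fromBlocks_toBlocks A.1.1] at hS ⊢
  refine fromBlocks_mem_commutatorMatrices hg hS ?_ ?_ ?_ ?_ ?_
  · intro i j
    have : (A.1.1.toBlocks₁₁ - 1) i j = 2 * M (Sum.inl i) (Sum.inl j) := by
      rw [e]; simp [Matrix.toBlocks₁₁, Matrix.one_apply]
    rw [this, h22]
    exact mul_dvd_mul_left _ (hp i j)
  all_goals
    intros
    simp only [e, Matrix.toBlocks₁₂, Matrix.toBlocks₂₁, Matrix.of_apply, Matrix.add_apply, ne_eq,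
      reduceCtorEq, not_false_eq_true, Matrix.one_apply_ne, zero_add, Matrix.smul_apply,
      smul_eq_mul]
  · rw [h22]; exact mul_dvd_mul_left _ (hq _ _)
  · rw [h248]; exact mul_dvd_mul_left _ (hq' _)
  · rw [h22]; exact mul_dvd_mul_left _ (hr _ _)
  · rw [h248]; exact mul_dvd_mul_left _ (hr' _)

lemma ker_abelianizationMap (hg : 2 ≤ g) :
    (abelianizationMap g).ker = commutator ↥(Gamma g 1) := by
  refine le_antisymm (fun A hA => ?_) (Abelianization.commutator_subset_ker _)
  have h := mem_commutatorMatrices.1 (coe_mem_commutatorMatrices_of_mem_ker hg hA)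
  rw [← Subgroup.map_subtype_commutator] at h
  obtain ⟨B, hB, hBA⟩ := h
  rwa [← Subtype.ext hBA]

lemma abelianizationMap_surjective (g : ℕ) : Function.Surjective (abelianizationMap g) := by
  intro t
  obtain ⟨⟨t₂, t₄⟩, rfl⟩ := Multiplicative.ofAdd.surjective t
  obtain ⟨σ, hσ⟩ := (ZMod.ringHom_surjective (PadicInt.toZMod (p := 2))).hasRightInverse
  obtain ⟨τ, hτ⟩ := (ZMod.ringHom_surjective (PadicInt.toZModPow (p := 2) 2)).hasRightInverse
  let P : Matrix (Fin g) (Fin g) ℤ_[2] := Matrix.of fun i j => σ (t₂ (Sum.inl (i, j)))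
  let S : Matrix (Fin g) (Fin g) ℤ_[2] := Matrix.of fun i j =>
    if h : i < j then σ (t₂ (Sum.inr ⟨(i, j), h.ne⟩))
    else if h : j < i then σ (t₂ (Sum.inr ⟨(j, i), h.ne⟩)) else τ (t₄ (Sum.inl i))
  let T : Matrix (Fin g) (Fin g) ℤ_[2] := Matrix.of fun i j =>
    if h : j < i then σ (t₂ (Sum.inr ⟨(i, j), h.ne'⟩))
    else if h : i < j then σ (t₂ (Sum.inr ⟨(j, i), h.ne'⟩)) else τ (t₄ (Sum.inr i))
  have hS : S.IsSymm := by
    ext i j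
    rcases lt_trichotomy i j with h | rfl | h
    · simp [S, h, h.not_gt]
    · simp [S]
    · simp [S, h, h.not_gt]
  have hT : T.IsSymm := by
    ext i j
    rcases lt_trichotomy i j with h | rfl | h
    · simp [T, h, h.not_gt]
    · simp [T]
    · simp [T, h, h.not_gt]
  obtain ⟨U, hU⟩ := exists_mem_Gamma_of_mem_gammaMatrices
    (upper_mem_gammaMatrices (n := 1) (hS.smul (2 : ℤ_[2])) (by simp))
  obtain ⟨L, hL⟩ := exists_mem_Gamma_of_mem_gammaMatrices
    (lower_mem_gammaMatrices (n := 1) (hT.smul (2 : ℤ_[2])) (by simp))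
  obtain ⟨a', ha'⟩ := exists_mul_eq_one_of_dvd_sub_one (a := 1 + (2 : ℤ_[2]) • P) (by simp)
  have hQ : a'.transpose = 1 + (2 : ℤ_[2]) • (-(P * a').transpose) := by
    rw [smul_neg, ← Matrix.transpose_smul, ← sub_eq_add_neg, ← Matrix.transpose_one,
      ← Matrix.transpose_sub]
    congr 1
    rw [← ha', add_mul, one_mul, smul_mul_assoc]
    abel
  obtain ⟨D, hD⟩ := exists_mem_Gamma_of_mem_gammaMatrices
    (fromBlocks_mem_gammaMatrices (n := 1)
      (levi_mem (a := 1 + (2 : ℤ_[2]) • P) (d := a'.transpose) (by simpa using ha'))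
      (by simp) (by simp) (by simp) (by rw [hQ]; simp))
  have hU' : U.1.1 = 1 + (2 : ℤ_[2]) • Matrix.fromBlocks 0 S 0 0 := by
    rw [hU, upper, ← Matrix.fromBlocks_one, Matrix.fromBlocks_smul, Matrix.fromBlocks_add]
    simp
  have hL' : L.1.1 = 1 + (2 : ℤ_[2]) • Matrix.fromBlocks 0 0 T 0 := by
    rw [hL, lower, ← Matrix.fromBlocks_one, Matrix.fromBlocks_smul, Matrix.fromBlocks_add]
    simp
  have hD' : D.1.1 = 1 + (2 : ℤ_[2]) • Matrix.fromBlocks P 0 0 (-(P * a').transpose) := by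
    rw [hD, hQ, ← Matrix.fromBlocks_one, Matrix.fromBlocks_smul, Matrix.fromBlocks_add]
    simp
  refine ⟨L * D * U, ?_⟩
  rw [map_mul, map_mul, abelianizationMap_apply hU', abelianizationMap_apply hL',
    abelianizationMap_apply hD', ← ofAdd_add, ← ofAdd_add, Prod.mk_add_mk, Prod.mk_add_mk]
  congr 2
  · funext k
    rcases k with x | ⟨⟨i, j⟩, hij⟩
    · simp [linearCoordinate, P, hσ _]
    · rcases lt_or_gt_of_ne hij with h | h
      · simp [linearCoordinate, S, h, hσ _]
      · simp [linearCoordinate, T, h, h.not_gt, hσ _]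
  · funext k
    rcases k with i | i
    · simp [quadraticCoordinate, S, hτ _]
    · simp [quadraticCoordinate, T, hτ _]

lemma card_linearIndex (g : ℕ) : Fintype.card (LinearIndex g) = 2 * g ^ 2 - g := by
  have h : Fintype.card {x : Fin g × Fin g // x.1 ≠ x.2} = g * g - g := by
    have := Finset.offDiag_card (Finset.univ : Finset (Fin g))
    rw [Finset.card_univ, Fintype.card_fin] at this
    rw [← this, Fintype.card_subtype]
    congr 1
    ext x
    simp
  rw [Fintype.card_sum, h, Fintype.card_prod, Fintype.card_fin]
  have : g ≤ g * g := Nat.le_mul_self g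
  rw [pow_two]
  omega

lemma Gamma_three_le (hg : 2 ≤ g) : Gamma g 3 ≤ ⁅Gamma g 1, Gamma g 1⁆ := by
  intro A hA
  rw [← mem_commutatorMatrices]
  have h := mem_Gamma_iff.1 hA
  have hS := A.2
  have h48 : (4 : ℤ_[2]) ∣ 2 ^ 3 := ⟨2, by norm_num⟩
  have h8 : (2 : ℤ_[2]) ^ 3 = 8 := by norm_num
  rw [← Matrix.fromBlocks_toBlocks A.1] at hS ⊢
  have hb : ∀ i j, (2 : ℤ_[2]) ^ 3 ∣ A.1.toBlocks₁₂ i j := fun i j => by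
    simpa [Matrix.toBlocks₁₂] using h (Sum.inl i) (Sum.inr j)
  have hc : ∀ i j, (2 : ℤ_[2]) ^ 3 ∣ A.1.toBlocks₂₁ i j := fun i j => by
    simpa [Matrix.toBlocks₂₁] using h (Sum.inr i) (Sum.inl j)
  refine fromBlocks_mem_commutatorMatrices hg hS (fun i j => h48.trans ?_)
    (fun i j => h48.trans (hb i j)) (fun i => h8 ▸ hb i i)
    (fun i j => h48.trans (hc i j)) (fun i => h8 ▸ hc i i)
  simpa [Matrix.toBlocks₁₁, Matrix.one_apply] using h (Sum.inl i) (Sum.inl j)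

end abelianization_map

/-- For `g ≥ 2`, the abelianization of `Γ(2) ≤ Sp_{2g}(ℤ₂)` is isomorphic to
`(ℤ/2ℤ)^{2g²-g} × (ℤ/4ℤ)^{2g}`; moreover `Γ(8)` is contained in the commutator subgroup
of `Γ(2)`, so the abelianization map of `Γ(2)` factors through `Γ(2)/Γ(8)`. -/
theorem stmt7 (g : ℕ) (hg : 2 ≤ g) :
    Nonempty (Abelianization ↥(Gamma g 1) ≃*
        Multiplicative ((Fin (2 * g ^ 2 - g) → ZMod 2) × (Fin (2 * g) → ZMod 4))) ∧
      Gamma g 3 ≤ Subgroup.map (Gamma g 1).subtype (commutator ↥(Gamma g 1)) ∧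
      ∀ A B : ↥(Gamma g 1), (A : ↥(Matrix.symplecticGroup (Fin g) ℤ_[2]))⁻¹ * B ∈ Gamma g 3 →
        Abelianization.of A = Abelianization.of B := by
  have hle : Gamma g 3 ≤ Subgroup.map (Gamma g 1).subtype (commutator ↥(Gamma g 1)) := by
    rw [Subgroup.map_subtype_commutator]
    exact Gamma_three_le hg
  refine ⟨⟨?_⟩, hle, fun A B h => ?_⟩
  · have e₁ : Abelianization ↥(Gamma g 1) ≃*
        Multiplicative ((LinearIndex g → ZMod 2) × (Fin g ⊕ Fin g → ZMod (2 ^ 2))) :=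
      (QuotientGroup.quotientMulEquivOfEq (ker_abelianizationMap hg).symm).trans
        (QuotientGroup.quotientKerEquivOfSurjective _ (abelianizationMap_surjective g))
    have e₂ : (LinearIndex g → ZMod 2) ≃+ (Fin (2 * g ^ 2 - g) → ZMod 2) :=
      AddEquiv.arrowCongr (Fintype.equivFinOfCardEq (card_linearIndex g)) (AddEquiv.refl _)
    have e₃ : (Fin g ⊕ Fin g → ZMod (2 ^ 2)) ≃+ (Fin (2 * g) → ZMod 4) :=
      AddEquiv.arrowCongr (Fintype.equivFinOfCardEq (by simp; ring))
        (ZMod.ringEquivCongr (by norm_num)).toAddEquiv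
    exact e₁.trans (AddEquiv.toMultiplicative (AddEquiv.prodCongr e₂ e₃))
  · obtain ⟨C, hC, hCe⟩ := hle h
    have : C = A⁻¹ * B := Subtype.ext hCe
    rw [this] at hC
    exact QuotientGroup.eq.2 hC

end PaperSp
end
end

section
/- The abelianization of the principal congruence subgroup Γ(2) of SL₂(ℤ₂) is isomorphic to ℤ/2ℤ × ℤ/8ℤ × ℤ/8ℤ. -/
set_option synthInstance.maxHeartbeats 400000
set_option maxHeartbeats 1000000

noncomputable section

/-- `Γ(2ⁿ)`, the principal congruence subgroup of level `2ⁿ` in `SL₂(ℤ₂)`: the kernel of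
the reduction map `SL₂(ℤ₂) → SL₂(ℤ/2ⁿℤ)`. -/
def GammaSL (n : ℕ) : Subgroup (Matrix.SpecialLinearGroup (Fin 2) ℤ_[2]) :=
  (Matrix.SpecialLinearGroup.map (PadicInt.toZModPow n)).ker

namespace GammaSL

/-- Reduction of 2-adic integers modulo `2`. -/
def mod2 : ℤ_[2] →+* ZMod 2 := PadicInt.toZModPow (p := 2) 1

/-- Reduction of 2-adic integers modulo `8`. -/
def mod8 : ℤ_[2] →+* ZMod 8 := PadicInt.toZModPow (p := 2) 3

lemma mod2_eq_zero_iff (x : ℤ_[2]) : mod2 x = 0 ↔ 2 ∣ x := by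
  have h := PadicInt.ker_toZModPow (p := 2) 1
  have : x ∈ RingHom.ker (PadicInt.toZModPow (p := 2) 1) ↔ 2 ∣ x := by
    rw [h, Ideal.mem_span_singleton]; norm_num
  exact this

lemma mod8_eq_zero_iff (x : ℤ_[2]) : mod8 x = 0 ↔ 8 ∣ x := by
  have h := PadicInt.ker_toZModPow (p := 2) 3
  have : x ∈ RingHom.ker (PadicInt.toZModPow (p := 2) 3) ↔ 8 ∣ x := by
    rw [h, Ideal.mem_span_singleton]; norm_num
  exact this

lemma mod8_surjective : Function.Surjective mod8 := fun z ↦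
  ⟨(z.val : ℤ_[2]), by rw [map_natCast]; exact ZMod.natCast_zmod_val z⟩

lemma mem_one_iff_forall (g : Matrix.SpecialLinearGroup (Fin 2) ℤ_[2]) :
    g ∈ GammaSL 1 ↔ ∀ i j, mod2 (g i j) = (1 : Matrix (Fin 2) (Fin 2) (ZMod 2)) i j := by
  rw [GammaSL, MonoidHom.mem_ker, Matrix.SpecialLinearGroup.ext_iff]
  rfl

lemma mem_one_iff (g : Matrix.SpecialLinearGroup (Fin 2) ℤ_[2]) :
    g ∈ GammaSL 1 ↔ 2 ∣ g 0 1 ∧ 2 ∣ g 1 0 := by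
  have hdet : mod2 (g 0 0) * mod2 (g 1 1) - mod2 (g 0 1) * mod2 (g 1 0) = 1 := by
    rw [← map_mul, ← map_mul, ← map_sub, ← Matrix.det_fin_two, g.det_coe, map_one]
  rw [mem_one_iff_forall, ← mod2_eq_zero_iff, ← mod2_eq_zero_iff]
  simp only [Fin.forall_fin_two, Matrix.one_apply_eq, ne_eq, zero_ne_one, not_false_eq_true,
    Matrix.one_apply_ne, one_ne_zero]
  generalize mod2 (g 0 0) = a at *
  generalize mod2 (g 0 1) = b at *
  generalize mod2 (g 1 0) = c at *
  generalize mod2 (g 1 1) = d at *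
  revert a b c d
  decide

/-- The element of `Γ(2)` with rows `(a, 2b)` and `(2c, d)`. -/
def ofEntries (a b c d : ℤ_[2]) (h : a * d - 4 * b * c = 1) : GammaSL 1 :=
  ⟨⟨!![a, 2 * b; 2 * c, d], by rw [Matrix.det_fin_two_of]; linear_combination h⟩,
    (mem_one_iff _).2 ⟨⟨b, rfl⟩, ⟨c, rfl⟩⟩⟩

lemma ofEntries_mul (a b c d a' b' c' d' : ℤ_[2]) (h : a * d - 4 * b * c = 1)
    (h' : a' * d' - 4 * b' * c' = 1) :
    ofEntries a b c d h * ofEntries a' b' c' d' h' =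
      ofEntries (a * a' + 4 * b * c') (a * b' + b * d') (c * a' + d * c') (4 * c * b' + d * d')
        (by linear_combination h * (a' * d' - 4 * b' * c') + h') := by
  apply Subtype.ext
  apply Subtype.ext
  change !![a, 2 * b; 2 * c, d] * !![a', 2 * b'; 2 * c', d'] = !![_, _; _, _]
  rw [Matrix.mul_fin_two]
  congr 1
  ext i j
  fin_cases i <;> fin_cases j <;> simp <;> ring

lemma ofEntries_congr {a b c d a' b' c' d' : ℤ_[2]} (h : a * d - 4 * b * c = 1)
    (h' : a' * d' - 4 * b' * c' = 1) (ha : a = a') (hb : b = b') (hc : c = c') (hd : d = d') :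
    ofEntries a b c d h = ofEntries a' b' c' d' h' := by
  subst ha hb hc hd; rfl

lemma isUnit_one_add_two_mul (x : ℤ_[2]) : IsUnit (1 + 2 * x) := by
  by_contra hx
  have h1 : (1 + 2 * x) ∈ IsLocalRing.maximalIdeal ℤ_[2] := hx
  have h2 : (2 : ℤ_[2]) ∈ IsLocalRing.maximalIdeal ℤ_[2] := by
    rw [PadicInt.maximalIdeal_eq_span_p]
    exact Ideal.mem_span_singleton_self _
  have h3 := sub_mem h1 (Ideal.mul_mem_right x _ h2)
  rw [add_sub_cancel_right] at h3
  exact (Ideal.ne_top_iff_one _).1 (IsLocalRing.maximalIdeal.isMaximal _).ne_top h3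

lemma exists_eq_ofEntries (g : GammaSL 1) :
    ∃ a b c d, ∃ h : (1 + 2 * a) * (1 + 2 * d) - 4 * b * c = 1,
      g = ofEntries (1 + 2 * a) b c (1 + 2 * d) h := by
  have hg := (mem_one_iff_forall _).1 g.2
  obtain ⟨a, ha⟩ := (mod2_eq_zero_iff (g.1 0 0 - 1)).1 (by rw [map_sub, hg]; simp)
  obtain ⟨b, hb⟩ := (mod2_eq_zero_iff (g.1 0 1)).1 (by rw [hg]; simp)
  obtain ⟨c, hc⟩ := (mod2_eq_zero_iff (g.1 1 0)).1 (by rw [hg]; simp)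
  obtain ⟨d, hd⟩ := (mod2_eq_zero_iff (g.1 1 1 - 1)).1 (by rw [map_sub, hg]; simp)
  have ha' : g.1 0 0 = 1 + 2 * a := by linear_combination ha
  have hd' : g.1 1 1 = 1 + 2 * d := by linear_combination hd
  have hdet := g.1.det_coe
  rw [Matrix.det_fin_two, ha', hb, hc, hd'] at hdet
  refine ⟨a, b, c, d, by linear_combination hdet, ?_⟩
  apply Subtype.ext
  apply Subtype.ext
  change g.1.1 = !![_, _; _, _]
  rw [← ha', ← hb, ← hc, ← hd']
  exact Matrix.eta_fin_two _

/-- The `ZMod 8`-valued character of `Γ(2)` in terms of half an off-diagonal entry, `b`, and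
`d = 1 + 2e`: it is the reduction of `b * d + (d² - 1) / 2`. -/
def charFun (b e : ZMod 8) : ZMod 8 := b * (1 + 2 * e) + 2 * e + 2 * e ^ 2

lemma four_mul_sq (x : ZMod 8) : 4 * x ^ 2 = 4 * x := by revert x; decide

lemma charFun_mul_upper (a b c d b' d' : ZMod 8) (h : a + d + 2 * a * d = 2 * b * c) :
    charFun ((1 + 2 * a) * b' + b * (1 + 2 * d')) (d + d' + 2 * d * d' + 2 * c * b') =
      charFun b d + charFun b' d' := by
  have h2 := four_mul_sq d'
  have h3 := four_mul_sq b'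
  have h8 : (8 : ZMod 8) = 0 := rfl
  unfold charFun
  linear_combination 2 * b' * (1 + 2 * d') * h + b * (1 + 2 * d) * (h2 + d' * h8) + c * h3 +
    h8 * (c * b' ^ 2 * a + c * b' * b * (1 + 2 * d') + c * b' + (d + d' + 2 * d * d') * c * b' +
      c ^ 2 * b' ^ 2 + (d ^ 2 + d) * (d' ^ 2 + d'))

lemma charFun_mul_lower (a' b' c' d' c d : ZMod 8) (h : a' + d' + 2 * a' * d' = 2 * b' * c') :
    charFun (c * (1 + 2 * a') + (1 + 2 * d) * c') (d + d' + 2 * d * d' + 2 * c * b') =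
      charFun c d + charFun c' d' := by
  have := charFun_mul_upper a' c' b' d' c d (by linear_combination h)
  rw [add_comm (charFun c d), ← this]
  congr 1 <;> ring

/-- The values of the three characters of `Γ(2)` on a matrix with rows
`(*, 2b)` and `(2c, 1 + 2d)`. -/
def charValue (b c d : ℤ_[2]) : ZMod 2 × ZMod 8 × ZMod 8 :=
  (mod2 d, charFun (mod8 b) (mod8 d), charFun (mod8 c) (mod8 d))

lemma exists_hom : ∃ φ : GammaSL 1 →* Multiplicative (ZMod 2 × ZMod 8 × ZMod 8),
    ∀ a b c d h, φ (ofEntries a b c (1 + 2 * d) h) = Multiplicative.ofAdd (charValue b c d) := by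
  choose a b c d h hg using exists_eq_ofEntries
  have two_ne : (2 : ℤ_[2]) ≠ 0 := two_ne_zero
  have key : ∀ g a' b' c' d' h', g = ofEntries a' b' c' (1 + 2 * d') h' →
      charValue (b g) (c g) (d g) = charValue b' c' d' := by
    intro g a' b' c' d' h' e
    have e' := (hg g).symm.trans e
    have e2 := congrArg (fun x : GammaSL 1 ↦ x.1.1) e'
    have hb : 2 * b g = 2 * b' := congrFun (congrFun e2 0) 1
    have hc : 2 * c g = 2 * c' := congrFun (congrFun e2 1) 0
    have hd : 1 + 2 * d g = 1 + 2 * d' := congrFun (congrFun e2 1) 1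
    rw [mul_left_cancel₀ two_ne hb, mul_left_cancel₀ two_ne hc,
      mul_left_cancel₀ two_ne (add_left_cancel hd)]
  refine ⟨MonoidHom.mk' (fun g ↦ Multiplicative.ofAdd (charValue (b g) (c g) (d g))) ?_,
    fun a' b' c' d' h' ↦ congrArg Multiplicative.ofAdd (key _ a' b' c' d' h' rfl)⟩
  intro x y
  have hdet : ∀ g, mod8 (a g) + mod8 (d g) + 2 * mod8 (a g) * mod8 (d g) =
      2 * mod8 (b g) * mod8 (c g) := by
    intro g
    have : a g + d g + 2 * a g * d g = 2 * b g * c g :=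
      mul_left_cancel₀ two_ne (by linear_combination h g)
    simpa only [map_mul, map_add, map_ofNat] using congrArg mod8 this
  have hxy := congrArg₂ (· * ·) (hg x) (hg y)
  simp only [ofEntries_mul] at hxy
  rw [← ofAdd_add]
  refine congrArg Multiplicative.ofAdd ?_
  have hdd : 4 * c x * b y + (1 + 2 * d x) * (1 + 2 * d y) =
      1 + 2 * (d x + d y + 2 * d x * d y + 2 * c x * b y) := by ring
  rw [key (x * y) _ _ _ (d x + d y + 2 * d x * d y + 2 * c x * b y) _
    (hxy.trans (ofEntries_congr _ (by
      linear_combination (h x) * ((1 + 2 * a y) * (1 + 2 * d y) - 4 * b y * c y) + h y)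
      rfl rfl rfl hdd))]
  have h2 : mod2 2 = 0 := (mod2_eq_zero_iff 2).2 dvd_rfl
  have h2' : mod8 2 = 2 := map_ofNat _ _
  refine Prod.ext ?_ (Prod.ext ?_ ?_)
  · simp [charValue, h2]
  · simpa [charValue, h2'] using charFun_mul_upper _ _ _ _ (mod8 (b y)) (mod8 (d y)) (hdet x)
  · simpa [charValue, h2'] using charFun_mul_lower _ _ _ _ (mod8 (c x)) (mod8 (d x)) (hdet y)

/-- The upper unipotent matrix with off-diagonal entry `2x`. -/
def upper (x : ℤ_[2]) : GammaSL 1 := ofEntries 1 x 0 1 (by ring)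

/-- The lower unipotent matrix with off-diagonal entry `2x`. -/
def lower (x : ℤ_[2]) : GammaSL 1 := ofEntries 1 0 x 1 (by ring)

/-- The diagonal matrix with entries `a` and `d`. -/
def diag (a d : ℤ_[2]) (h : a * d = 1) : GammaSL 1 := ofEntries a 0 0 d (by linear_combination h)

lemma upper_add (x y : ℤ_[2]) : upper (x + y) = upper x * upper y := by
  simp only [upper, ofEntries_mul]
  apply ofEntries_congr <;> ring

lemma lower_add (x y : ℤ_[2]) : lower (x + y) = lower x * lower y := by
  simp only [lower, ofEntries_mul]
  apply ofEntries_congr <;> ring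

lemma exists_three_mul : ∃ e : ℤ_[2], 3 * e = 1 := by
  obtain ⟨e, he⟩ := (isUnit_one_add_two_mul 1).exists_right_inv
  exact ⟨e, by linear_combination he⟩

lemma of_upper_eq_one {x : ℤ_[2]} (hx : mod8 x = 0) : Abelianization.of (upper x) = 1 := by
  obtain ⟨y, rfl⟩ := (mod8_eq_zero_iff x).1 hx
  obtain ⟨e, he⟩ := exists_three_mul
  have h : diag 3 e he * upper y = upper (8 * y) * upper y * diag 3 e he := by
    rw [← upper_add]
    simp only [upper, diag, ofEntries_mul]
    apply ofEntries_congr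
    · ring
    · linear_combination (-3 * y) * he
    · ring
    · ring
  have h' := congrArg Abelianization.of h
  rw [map_mul, map_mul, map_mul, mul_comm, mul_assoc] at h'
  exact (mul_eq_right.1 h'.symm)

lemma of_lower_eq_one {x : ℤ_[2]} (hx : mod8 x = 0) : Abelianization.of (lower x) = 1 := by
  obtain ⟨y, rfl⟩ := (mod8_eq_zero_iff x).1 hx
  obtain ⟨e, he⟩ := exists_three_mul
  have he' : e * 3 = 1 := by linear_combination he
  have h : diag e 3 he' * lower y = lower (8 * y) * lower y * diag e 3 he' := by
    rw [← lower_add]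
    simp only [lower, diag, ofEntries_mul]
    apply ofEntries_congr
    · ring
    · ring
    · linear_combination (-3 * y) * he
    · ring
  have h' := congrArg Abelianization.of h
  rw [map_mul, map_mul, map_mul, mul_comm, mul_assoc] at h'
  exact (mul_eq_right.1 h'.symm)

lemma of_diag (k e : ℤ_[2]) (h : e * (1 + 4 * k) = 1) :
    Abelianization.of (diag e (1 + 4 * k) h) =
      Abelianization.of (upper (4 * k * e)) * Abelianization.of (lower (4 * k ^ 2 * e)) := by
  have h1 : lower (k * e + 4 * k ^ 2 * e) * upper (4 * k * e + e) =
      upper e * diag e (1 + 4 * k) h * lower (k * e) := by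
    simp only [lower, upper, diag, ofEntries_mul]
    apply ofEntries_congr
    · linear_combination (-(1 + 4 * k * e)) * h
    · ring
    · ring
    · linear_combination 4 * k * (e * (1 + 4 * k) + 1) * h
  have h' := congrArg Abelianization.of h1
  rw [lower_add, upper_add] at h'
  simp only [map_mul] at h'
  generalize Abelianization.of (diag e (1 + 4 * k) h) = D at *
  generalize Abelianization.of (upper e) = u at *
  generalize Abelianization.of (lower (k * e)) = l at *
  generalize Abelianization.of (upper (4 * k * e)) = U at *
  generalize Abelianization.of (lower (4 * k ^ 2 * e)) = L at *
  have h2 : (u * l) * D = (u * l) * (U * L) := by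
    calc (u * l) * D = u * D * l := mul_right_comm _ _ _
      _ = l * L * (U * u) := h'.symm
      _ = (u * l) * (U * L) := by
        simp only [mul_comm, mul_left_comm]
  exact mul_left_cancel h2

lemma of_eq_one_of_charValue_eq_zero (a b c d : ℤ_[2]) (h : a * (1 + 2 * d) - 4 * b * c = 1)
    (hv : charValue b c d = 0) : Abelianization.of (ofEntries a b c (1 + 2 * d) h) = 1 := by
  simp only [charValue, Prod.mk_eq_zero] at hv
  obtain ⟨h1, h2, h3⟩ := hv
  obtain ⟨k, rfl⟩ := (mod2_eq_zero_iff d).1 h1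
  obtain ⟨e, he⟩ := (isUnit_one_add_two_mul (2 * k)).exists_left_inv
  have he' : e * (1 + 4 * k) = 1 := by linear_combination he
  have hfac : ofEntries a b c (1 + 2 * (2 * k)) h =
      upper (b * e) * diag e (1 + 4 * k) he' * lower (c * e) := by
    simp only [lower, upper, diag, ofEntries_mul]
    apply ofEntries_congr
    · linear_combination e * h - (a + 4 * b * c * e) * he'
    · linear_combination (-b) * he'
    · linear_combination (-c) * he'
    · ring
  have hE : mod8 e * (1 + 4 * mod8 k) = 1 := by
    simpa only [map_mul, map_add, map_one, map_ofNat] using congrArg mod8 he'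
  have h8 : (8 : ZMod 8) = 0 := rfl
  have s1 := four_mul_sq (mod8 e)
  have s2 := four_mul_sq (mod8 k)
  simp only [charFun, map_mul, map_ofNat] at h2 h3
  have hu : mod8 (b * e + 4 * k * e) = 0 := by
    simp only [map_mul, map_ofNat, map_add]
    linear_combination mod8 e ^ 2 * h2 - mod8 b * mod8 e * hE - mod8 k ^ 2 * mod8 e ^ 2 * h8 -
      mod8 k * s1
  have hl : mod8 (c * e + 4 * k ^ 2 * e) = 0 := by
    simp only [map_mul, map_ofNat, map_add, map_pow]
    linear_combination mod8 e ^ 2 * h3 - mod8 c * mod8 e * hE - mod8 k ^ 2 * mod8 e ^ 2 * h8 -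
      mod8 k * s1 + mod8 e * s2
  have hu' := of_upper_eq_one hu
  have hl' := of_lower_eq_one hl
  rw [upper_add, map_mul] at hu'
  rw [lower_add, map_mul] at hl'
  rw [hfac, map_mul, map_mul, of_diag, ← mul_assoc, hu', one_mul, mul_comm, hl']

end GammaSL

open GammaSL in
/-- The abelianization of the principal congruence subgroup `Γ(2)` of `SL₂(ℤ₂)` is
isomorphic to `ℤ/2ℤ × ℤ/8ℤ × ℤ/8ℤ`. -/
theorem stmt8 :
    Nonempty (Abelianization ↥(GammaSL 1) ≃* Multiplicative (ZMod 2 × ZMod 8 × ZMod 8)) := by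
  obtain ⟨φ, hφ⟩ := exists_hom
  refine ⟨MulEquiv.ofBijective (Abelianization.lift φ) ⟨?_, ?_⟩⟩
  · rw [injective_iff_map_eq_one]
    intro q hq
    obtain ⟨g, rfl⟩ := QuotientGroup.mk_surjective q
    obtain ⟨a, b, c, d, h, rfl⟩ := exists_eq_ofEntries g
    exact of_eq_one_of_charValue_eq_zero _ _ _ _ _ ((hφ _ _ _ _ _).symm.trans hq)
  · rintro ⟨i, m, n⟩
    obtain ⟨x, rfl⟩ := mod8_surjective m
    obtain ⟨y, rfl⟩ := mod8_surjective n
    have hu : φ (upper x) = Multiplicative.ofAdd (0, mod8 x, 0) := by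
      have := hφ 1 x 0 0 (by ring)
      simpa [charValue, charFun, upper] using this
    have hl : φ (lower y) = Multiplicative.ofAdd (0, 0, mod8 y) := by
      have := hφ 1 0 y 0 (by ring)
      simpa [charValue, charFun, lower] using this
    have hs : φ (diag (-1) (1 + 2 * (-1)) (by ring)) = Multiplicative.ofAdd (1, 0, 0) := by
      have := hφ (-1) 0 0 (-1) (by ring)
      simpa [charValue, charFun, diag] using this
    refine ⟨Abelianization.of (diag (-1) (1 + 2 * (-1)) (by ring) ^ i.val * upper x * lower y), ?_⟩
    rw [Abelianization.lift_apply_of, map_mul, map_mul, map_pow, hs, hu, hl, ← ofAdd_nsmul,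
      ← ofAdd_add, ← ofAdd_add]
    refine congrArg Multiplicative.ofAdd ?_
    simp
end
end

section
/- The principal congruence subgroup Γ(16) of SL₂(ℤ₂) is contained in the commutator subgroup of Γ(2); consequently the abelianization map of Γ(2) factors through Γ(2)/Γ(16). -/
set_option synthInstance.maxHeartbeats 400000
set_option maxHeartbeats 1000000

noncomputable section

theorem mem_GammaSL_iff (n : ℕ) (A : Matrix.SpecialLinearGroup (Fin 2) ℤ_[2]) :
    A ∈ GammaSL n ↔ (2 ^ n : ℤ_[2]) ∣ A 0 0 - 1 ∧ (2 ^ n : ℤ_[2]) ∣ A 0 1 ∧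
      (2 ^ n : ℤ_[2]) ∣ A 1 0 ∧ (2 ^ n : ℤ_[2]) ∣ A 1 1 - 1 := by
  have key (x : ℤ_[2]) : (2 ^ n : ℤ_[2]) ∣ x ↔ PadicInt.toZModPow n x = 0 := by
    rw [← RingHom.mem_ker, PadicInt.ker_toZModPow, Ideal.mem_span_singleton, Nat.cast_ofNat]
  simp only [key, map_sub, map_one, sub_eq_zero, GammaSL, MonoidHom.mem_ker]
  rw [Matrix.SpecialLinearGroup.ext_iff]
  simp [Fin.forall_fin_two, and_assoc]

open scoped commutatorElement

section SpecialLinear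

variable {R : Type*} [CommRing R]

/-- The upper unitriangular matrix with off-diagonal entry `b`. -/
def upperUni (b : R) : Matrix.SpecialLinearGroup (Fin 2) R :=
  ⟨!![1, b; 0, 1], by simp [Matrix.det_fin_two_of]⟩

/-- The lower unitriangular matrix with off-diagonal entry `c`. -/
def lowerUni (c : R) : Matrix.SpecialLinearGroup (Fin 2) R :=
  ⟨!![1, 0; c, 1], by simp [Matrix.det_fin_two_of]⟩

/-- The diagonal matrix `diag(u, u⁻¹)`. -/
def diagUnit (u : Rˣ) : Matrix.SpecialLinearGroup (Fin 2) R :=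
  ⟨!![(u : R), 0; 0, ((u⁻¹ : Rˣ) : R)], by simp [Matrix.det_fin_two_of]⟩

theorem commutator_diagUnit_upperUni (u : Rˣ) (b : R) :
    ⁅diagUnit u, upperUni b⁆ = upperUni (((u : R) ^ 2 - 1) * b) := by
  rw [commutatorElement_def, mul_inv_eq_iff_eq_mul, mul_inv_eq_iff_eq_mul]
  ext i j
  have h := u.mul_inv
  simp only [Matrix.SpecialLinearGroup.coe_mul]
  fin_cases i <;> fin_cases j <;>
    simp [diagUnit, upperUni, Matrix.mul_apply, Fin.sum_univ_two]
  linear_combination (-(u : R) * b) * h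

theorem commutator_diagUnit_inv_lowerUni (u : Rˣ) (c : R) :
    ⁅diagUnit u⁻¹, lowerUni c⁆ = lowerUni (((u : R) ^ 2 - 1) * c) := by
  rw [commutatorElement_def, mul_inv_eq_iff_eq_mul, mul_inv_eq_iff_eq_mul]
  ext i j
  have h := u.mul_inv
  simp only [Matrix.SpecialLinearGroup.coe_mul]
  fin_cases i <;> fin_cases j <;>
    simp [diagUnit, lowerUni, Matrix.mul_apply, Fin.sum_univ_two]
  linear_combination (-(u : R) * c) * h

theorem commutator_upperUni_lowerUni (b c : R) :
    (⁅upperUni b, lowerUni c⁆ : Matrix.SpecialLinearGroup (Fin 2) R).1 =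
      !![1 + b * c + (b * c) ^ 2, -(b * (b * c)); c * (b * c), 1 - b * c] := by
  simp only [commutatorElement_def, Matrix.SpecialLinearGroup.coe_mul,
    Matrix.SpecialLinearGroup.coe_inv]
  ext i j
  fin_cases i <;> fin_cases j <;>
    simp [upperUni, lowerUni, Matrix.adjugate_fin_two, Matrix.mul_apply,
      Fin.sum_univ_two] <;> ring

/-- A matrix of determinant one whose lower right entry is the unit `1 - bc` differs from
`⁅upperUni b, lowerUni c⁆` by unitriangular factors. -/
theorem eq_upperUni_mul_commutator_mul_lowerUni (A : Matrix.SpecialLinearGroup (Fin 2) R)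
    (b c e : R) (hA : A 1 1 = 1 - b * c) (he : A 1 1 * e = 1) :
    A = upperUni ((A 0 1 + b * (b * c)) * e) * ⁅upperUni b, lowerUni c⁆ *
      lowerUni ((A 1 0 - c * (b * c)) * e) := by
  have hdet : A 0 0 * A 1 1 - A 0 1 * A 1 0 = 1 := by
    rw [← Matrix.det_fin_two]; exact A.det_coe
  have he' : (1 - b * c) * e = 1 := hA ▸ he
  rw [hA] at hdet
  ext i j
  rw [Matrix.SpecialLinearGroup.coe_mul, Matrix.SpecialLinearGroup.coe_mul,
    commutator_upperUni_lowerUni]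
  fin_cases i <;> fin_cases j <;>
    simp [upperUni, lowerUni, Matrix.mul_apply, Fin.sum_univ_two]
  · have hmul : (1 - b * c) * A 0 0 = (1 - b * c) * (1 + b * c + (b * c) ^ 2 +
        (A 0 1 + b * (b * c)) * e * (c * (b * c)) + (-(b * (b * c)) +
        (A 0 1 + b * (b * c)) * e * (1 - b * c)) * ((A 1 0 - c * (b * c)) * e)) := by
      linear_combination hdet - ((A 0 1 + b * (b * c)) * (c * (b * c)) +
        A 0 1 * (A 1 0 - c * (b * c)) +
        (A 0 1 + b * (b * c)) * (A 1 0 - c * (b * c)) * (e * (1 - b * c))) * he'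
    exact (IsUnit.of_mul_eq_one e he').mul_left_cancel hmul
  · linear_combination (-(A 0 1 + b * (b * c))) * he'
  · linear_combination (-(A 1 0 - c * (b * c))) * he'
  · exact hA

end SpecialLinear

theorem GammaSL_four_le_commutator : GammaSL 4 ≤ ⁅GammaSL 1, GammaSL 1⁆ := by
  have isUnit_of (x : ℤ_[2]) (hx : (2 : ℤ_[2]) ∣ x - 1) : IsUnit x := by
    by_contra h
    have h2 : (2 : ℤ_[2]) ∣ x := by
      have := PadicInt.maximalIdeal_eq_span_p (p := 2) ▸
        (IsLocalRing.mem_maximalIdeal x).2 h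
      simpa [Ideal.mem_span_singleton] using this
    have h1 : (2 : ℤ_[2]) ∣ 1 := by simpa using dvd_sub h2 hx
    exact PadicInt.prime_p (p := 2) |>.not_isUnit (by simpa using isUnit_of_dvd_one h1)
  have upper_mem (b : ℤ_[2]) (hb : 2 ∣ b) : upperUni b ∈ GammaSL 1 := by
    rw [mem_GammaSL_iff]; simp [upperUni, hb]
  have lower_mem (c : ℤ_[2]) (hc : 2 ∣ c) : lowerUni c ∈ GammaSL 1 := by
    rw [mem_GammaSL_iff]; simp [lowerUni, hc]
  obtain ⟨u, hu⟩ := isUnit_of 3 ⟨1, by norm_num⟩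
  have hu_inv : (2 : ℤ_[2]) ∣ (u⁻¹ : ℤ_[2]ˣ) - 1 := by
    refine ⟨-(u⁻¹ : ℤ_[2]ˣ), ?_⟩
    have := u.mul_inv
    rw [hu] at this
    linear_combination this
  have hu_sub : (2 : ℤ_[2]) ∣ (u : ℤ_[2]) - 1 := ⟨1, by rw [hu]; norm_num⟩
  have upper_comm (b : ℤ_[2]) (hb : 16 ∣ b) : upperUni b ∈ ⁅GammaSL 1, GammaSL 1⁆ := by
    obtain ⟨m, rfl⟩ := hb
    have h := Subgroup.commutator_mem_commutator (H₁ := GammaSL 1) (H₂ := GammaSL 1)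
      (g₁ := diagUnit u) (by rw [mem_GammaSL_iff]; simp [diagUnit, hu_inv, hu_sub])
      (upper_mem (2 * m) ⟨m, rfl⟩)
    rwa [commutator_diagUnit_upperUni, hu,
      show ((3 : ℤ_[2]) ^ 2 - 1) * (2 * m) = 16 * m by ring] at h
  have lower_comm (c : ℤ_[2]) (hc : 16 ∣ c) : lowerUni c ∈ ⁅GammaSL 1, GammaSL 1⁆ := by
    obtain ⟨m, rfl⟩ := hc
    have h := Subgroup.commutator_mem_commutator (H₁ := GammaSL 1) (H₂ := GammaSL 1)
      (g₁ := diagUnit u⁻¹) (by rw [mem_GammaSL_iff]; simp [diagUnit, hu_inv, hu_sub])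
      (lower_mem (2 * m) ⟨m, rfl⟩)
    rwa [commutator_diagUnit_inv_lowerUni, hu,
      show ((3 : ℤ_[2]) ^ 2 - 1) * (2 * m) = 16 * m by ring] at h
  intro A hA
  obtain ⟨-, ⟨p, hp⟩, ⟨q, hq⟩, ⟨k, hk⟩⟩ := (mem_GammaSL_iff 4 A).1 hA
  obtain ⟨e, he⟩ := (isUnit_of (A 1 1) ⟨8 * k, by rw [hk]; ring⟩).exists_right_inv
  rw [eq_upperUni_mul_commutator_mul_lowerUni A 2 (-8 * k) e (by linear_combination hk) he]
  refine mul_mem (mul_mem (upper_comm _ ?_) (Subgroup.commutator_mem_commutator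
    (upper_mem _ dvd_rfl) (lower_mem (-8 * k) ⟨-4 * k, by ring⟩))) (lower_comm _ ?_)
  · exact ⟨(p - 2 * k) * e, by rw [hp]; ring⟩
  · exact ⟨(q - 8 * k ^ 2) * e, by rw [hq]; ring⟩

/-- `Γ(16)` is contained in the commutator subgroup of `Γ(2)` in `SL₂(ℤ₂)`; consequently
the abelianization map of `Γ(2)` factors through `Γ(2)/Γ(16)`. -/
theorem stmt9 :
    GammaSL 4 ≤ Subgroup.map (GammaSL 1).subtype (commutator ↥(GammaSL 1)) ∧
      ∀ A B : ↥(GammaSL 1),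
        (A : Matrix.SpecialLinearGroup (Fin 2) ℤ_[2])⁻¹ * B ∈ GammaSL 4 →
          Abelianization.of A = Abelianization.of B := by
  have h : GammaSL 4 ≤ Subgroup.map (GammaSL 1).subtype (commutator ↥(GammaSL 1)) := by
    rw [Subgroup.map_subtype_commutator]
    exact GammaSL_four_le_commutator
  refine ⟨h, fun A B hAB => ?_⟩
  obtain ⟨C, hC, hCAB⟩ := h hAB
  have hCeq : C = A⁻¹ * B := Subtype.ext (by simpa using hCAB)
  rw [hCeq] at hC
  exact QuotientGroup.eq.2 hC
end
end

section
/- Let n ≥ 1 and let A, B ∈ SL₂(ℤ₂) with B ≡ I (mod 2) (entrywise) and A ≡ B (mod 2ⁿ) (entrywise). Then A² ≡ B² (mod 2^{n+1}) (entrywise). -/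
theorem Matrix.exists_eq_add_smul_of_dvd_sub {m n R : Type*} [CommRing R] {r : R}
    {M N : Matrix m n R} (h : ∀ i j, r ∣ M i j - N i j) : ∃ C : Matrix m n R, M = N + r • C := by
  choose C hC using h
  refine ⟨Matrix.of C, ?_⟩
  ext i j
  simp [← hC]

theorem Matrix.two_pow_succ_dvd_sq_sub_sq {m R : Type*} [Fintype m] [DecidableEq m] [CommRing R]
    {n : ℕ} (hn : 1 ≤ n) {M N : Matrix m m R}
    (hN : ∀ i j, (2 : R) ∣ N i j - (1 : Matrix m m R) i j)
    (hMN : ∀ i j, (2 : R) ^ n ∣ M i j - N i j) (i j : m) :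
    (2 : R) ^ (n + 1) ∣ (M ^ 2) i j - (N ^ 2) i j := by
  obtain ⟨k, rfl⟩ := Nat.exists_eq_add_of_le' hn
  obtain ⟨D, hD⟩ := Matrix.exists_eq_add_smul_of_dvd_sub hN
  obtain ⟨C, rfl⟩ := Matrix.exists_eq_add_smul_of_dvd_sub hMN
  have key : (N + (2 : R) ^ (k + 1) • C) ^ 2 =
      N ^ 2 + (2 : R) ^ (k + 1 + 1) • (C + D * C + C * D + (2 : R) ^ k • C ^ 2) := by
    subst hD
    simp only [sq, add_mul, mul_add, smul_mul_assoc, mul_smul_comm, one_mul, mul_one, smul_add,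
      smul_smul]
    module
  refine ⟨(C + D * C + C * D + (2 : R) ^ k • C ^ 2) i j, ?_⟩
  rw [key, Matrix.add_apply, Matrix.smul_apply, smul_eq_mul, add_sub_cancel_left]

/-- Let `n ≥ 1` and let `A, B ∈ SL₂(ℤ₂)` with `B ≡ I (mod 2)` and `A ≡ B (mod 2ⁿ)`
entrywise.  Then `A² ≡ B² (mod 2^{n+1})` entrywise. -/
theorem stmt12 (n : ℕ) (hn : 1 ≤ n) (A B : Matrix.SpecialLinearGroup (Fin 2) ℤ_[2])
    (hB : ∀ i j, (2 : ℤ_[2]) ∣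
      ((B : Matrix (Fin 2) (Fin 2) ℤ_[2]) i j - (1 : Matrix (Fin 2) (Fin 2) ℤ_[2]) i j))
    (hAB : ∀ i j, (2 : ℤ_[2]) ^ n ∣
      ((A : Matrix (Fin 2) (Fin 2) ℤ_[2]) i j - (B : Matrix (Fin 2) (Fin 2) ℤ_[2]) i j)) :
    ∀ i j, (2 : ℤ_[2]) ^ (n + 1) ∣
      ((A ^ 2 : Matrix.SpecialLinearGroup (Fin 2) ℤ_[2]) : Matrix (Fin 2) (Fin 2) ℤ_[2]) i j -
        ((B ^ 2 : Matrix.SpecialLinearGroup (Fin 2) ℤ_[2]) : Matrix (Fin 2) (Fin 2) ℤ_[2]) i j := by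
  intro i j
  simpa only [Matrix.SpecialLinearGroup.coe_pow] using
    Matrix.two_pow_succ_dvd_sq_sub_sq hn hB hAB i j
end

section
/- The image of the commutator subgroup of Γ(2) under the reduction map SL₂(ℤ₂) → SL₂(ℤ/16ℤ) equals the cyclic subgroup generated by the image of the commutator στσ^{−1}τ^{−1}, and this cyclic subgroup has order 4. -/
set_option synthInstance.maxHeartbeats 400000
set_option maxHeartbeats 1000000

noncomputable section

open Matrix
open scoped commutatorElement

/-- A subgroup that commutes with a generating set and contains the commutators of the
generators contains every commutator. -/
theorem Subgroup.commutator_closure_le_of_commute {G : Type*} [Group G] {S : Set G}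
    {N : Subgroup G} (hN : ∀ s ∈ S, ∀ n ∈ N, s * n = n * s)
    (hS : ∀ s ∈ S, ∀ t ∈ S, ⁅s, t⁆ ∈ N) : ⁅closure S, closure S⁆ ≤ N := by
  have hc : ∀ g ∈ closure S, ∀ n ∈ N, g * n * g⁻¹ = n := by
    have h : closure S ≤ centralizer (N : Set G) := by
      rw [closure_le]
      intro s hs
      rw [SetLike.mem_coe, mem_centralizer_iff]
      exact fun n hn => (hN s hs n hn).symm
    intro g hg n hn
    rw [← mem_centralizer_iff.1 (h hg) n hn, mul_inv_cancel_right]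
  have mul_left : ∀ x ∈ closure S, ∀ y z : G, ⁅x, z⁆ ∈ N → ⁅y, z⁆ ∈ N → ⁅x * y, z⁆ ∈ N := by
    intro x hx y z h1 h2
    have : ⁅x * y, z⁆ = x * ⁅y, z⁆ * x⁻¹ * ⁅x, z⁆ := by
      simp only [commutatorElement_def]; group
    rw [this, hc x hx _ h2]
    exact N.mul_mem h2 h1
  have inv_left : ∀ x ∈ closure S, ∀ z : G, ⁅x, z⁆ ∈ N → ⁅x⁻¹, z⁆ ∈ N := by
    intro x hx z h
    have : ⁅x⁻¹, z⁆ = x⁻¹ * ⁅x, z⁆⁻¹ * x⁻¹⁻¹ := by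
      simp only [commutatorElement_def]; group
    rw [this, hc _ (inv_mem hx) _ (inv_mem h)]
    exact inv_mem h
  have swap : ∀ x y : G, ⁅x, y⁆ ∈ N → ⁅y, x⁆ ∈ N := fun x y h => by
    rw [← commutatorElement_inv]; exact inv_mem h
  have gen : ∀ x ∈ closure S, ∀ t ∈ S, ⁅x, t⁆ ∈ N := by
    intro x hx t ht
    induction hx using closure_induction with
    | mem s hs => exact hS s hs t ht
    | one => simp
    | mul x y hx _ h1 h2 => exact mul_left x hx y t h1 h2
    | inv x hx h => exact inv_left x hx t h
  rw [commutator_le]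
  intro x hx y hy
  refine swap _ _ ?_
  induction hy using closure_induction with
  | mem t ht => exact swap _ _ (gen x hx t ht)
  | one => simp
  | mul y z hy _ h1 h2 => exact mul_left y hy z x h1 h2
  | inv y hy h => exact inv_left y hy x h

theorem Matrix.SpecialLinearGroup.eq_of_coe_eq {n R : Type*} [Fintype n] [DecidableEq n]
    [CommRing R] {A B : Matrix.SpecialLinearGroup n R}
    (h : (A : Matrix n n R) = (B : Matrix n n R)) : A = B :=
  Subtype.ext h

section

variable (R : Type*) [CommRing R]

/-- The upper unipotent matrix `[[1, -2], [0, 1]]` over `R`. -/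
def upperSL : Matrix.SpecialLinearGroup (Fin 2) R :=
  ⟨!![1, -2; 0, 1], by simp [det_fin_two]⟩

/-- The lower unipotent matrix `[[1, 0], [2, 1]]` over `R`. -/
def lowerSL : Matrix.SpecialLinearGroup (Fin 2) R :=
  ⟨!![1, 0; 2, 1], by simp [det_fin_two]⟩

variable {R}

/-- The diagonal matrix `[[p, 0], [0, p³]]` for `p` with `p⁴ = 1`. -/
def diagSL (p : R) (hp : p ^ 4 = 1) : Matrix.SpecialLinearGroup (Fin 2) R :=
  ⟨!![p, 0; 0, p ^ 3], by rw [det_fin_two_of]; linear_combination hp⟩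

theorem coe_upperSL : (upperSL R : Matrix (Fin 2) (Fin 2) R) = !![1, -2; 0, 1] := rfl

theorem coe_lowerSL : (lowerSL R : Matrix (Fin 2) (Fin 2) R) = !![1, 0; 2, 1] := rfl

theorem coe_diagSL (p : R) (hp : p ^ 4 = 1) :
    (diagSL p hp : Matrix (Fin 2) (Fin 2) R) = !![p, 0; 0, p ^ 3] := rfl

theorem diagSL_commute (p q : R) (hp : p ^ 4 = 1) (hq : q ^ 4 = 1) :
    Commute (diagSL p hp) (diagSL q hq) := by
  apply Matrix.SpecialLinearGroup.eq_of_coe_eq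
  rw [Matrix.SpecialLinearGroup.coe_mul, Matrix.SpecialLinearGroup.coe_mul, coe_diagSL, coe_diagSL]
  simp [mul_comm]

theorem coe_upperSL_pow (n : ℕ) :
    ((upperSL R ^ n : Matrix.SpecialLinearGroup (Fin 2) R) : Matrix (Fin 2) (Fin 2) R) =
      !![1, -2 * (n : R); 0, 1] := by
  induction n with
  | zero => simp [one_fin_two]
  | succ n ih =>
    rw [pow_succ, Matrix.SpecialLinearGroup.coe_mul, ih, coe_upperSL]
    simp
    ring

theorem coe_lowerSL_pow (n : ℕ) :
    ((lowerSL R ^ n : Matrix.SpecialLinearGroup (Fin 2) R) : Matrix (Fin 2) (Fin 2) R) =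
      !![1, 0; 2 * (n : R), 1] := by
  induction n with
  | zero => simp [one_fin_two]
  | succ n ih =>
    rw [pow_succ, Matrix.SpecialLinearGroup.coe_mul, ih, coe_lowerSL]
    simp
    ring

/-- A lower-diagonal-upper factorisation over `R`. -/
theorem eq_lowerSL_mul_diagSL_mul_upperSL {g : Matrix.SpecialLinearGroup (Fin 2) R}
    {i j : R} {k l : ℕ} (h00 : g 0 0 ^ 4 = 1) (h10 : g 1 0 = 2 * i) (h01 : g 0 1 = 2 * j)
    (hk : (k : R) = i * g 0 0 ^ 3) (hl : (l : R) = -j * g 0 0 ^ 3) :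
    g = lowerSL R ^ k * diagSL (g 0 0) h00 * upperSL R ^ l := by
  have hdet := g.det_coe
  rw [det_fin_two] at hdet
  apply Matrix.SpecialLinearGroup.eq_of_coe_eq
  rw [Matrix.SpecialLinearGroup.coe_mul, Matrix.SpecialLinearGroup.coe_mul, coe_upperSL_pow,
    coe_lowerSL_pow, hk, hl, coe_diagSL]
  ext a b
  fin_cases a <;> fin_cases b <;> simp
  · linear_combination h01 - 2 * j * h00
  · linear_combination h10 - 2 * i * h00
  · linear_combination g 0 0 ^ 3 * hdet - (g 1 1 + 4 * i * j * g 0 0 ^ 3) * h00 +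
      g 0 0 ^ 3 * (g 1 0 * h01 + 2 * j * h10)

/-- Reduction along a ring homomorphism sends `[[1, -2], [0, 1]]` to `[[1, -2], [0, 1]]`. -/
theorem map_eq_upperSL {S : Type*} [CommRing S] (f : S →+* R)
    {σ : Matrix.SpecialLinearGroup (Fin 2) S}
    (hσ : (σ : Matrix (Fin 2) (Fin 2) S) = !![1, -2; 0, 1]) :
    Matrix.SpecialLinearGroup.map f σ = upperSL R := by
  apply Matrix.SpecialLinearGroup.eq_of_coe_eq
  rw [Matrix.SpecialLinearGroup.map_apply_coe, hσ, coe_upperSL]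
  ext i j
  fin_cases i <;> fin_cases j <;> simp [map_ofNat f 2]

/-- Reduction along a ring homomorphism sends `[[1, 0], [2, 1]]` to `[[1, 0], [2, 1]]`. -/
theorem map_eq_lowerSL {S : Type*} [CommRing S] (f : S →+* R)
    {τ : Matrix.SpecialLinearGroup (Fin 2) S}
    (hτ : (τ : Matrix (Fin 2) (Fin 2) S) = !![1, 0; 2, 1]) :
    Matrix.SpecialLinearGroup.map f τ = lowerSL R := by
  apply Matrix.SpecialLinearGroup.eq_of_coe_eq
  rw [Matrix.SpecialLinearGroup.map_apply_coe, hτ, coe_lowerSL]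
  ext i j
  fin_cases i <;> fin_cases j <;> simp [map_ofNat f 2]

theorem apply_eq_of_map_eq_one {S : Type*} [CommRing S] {f : S →+* R}
    {g : Matrix.SpecialLinearGroup (Fin 2) S} (h : Matrix.SpecialLinearGroup.map f g = 1)
    (a b : Fin 2) :
    f (g a b) = (1 : Matrix (Fin 2) (Fin 2) R) a b :=
  congrFun (congrFun (congrArg Subtype.val h) a) b

end

/-- Generators of the image of `Γ(2)` in `SL₂(ℤ/16ℤ)`. -/
def gammaGenerators : Set (Matrix.SpecialLinearGroup (Fin 2) (ZMod (2 ^ 4))) :=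
  {upperSL (ZMod (2 ^ 4)), lowerSL (ZMod (2 ^ 4))} ∪ {g | ∃ p hp, g = diagSL p hp}

theorem diagSL_commute_upper (p : ZMod (2 ^ 4)) (hp : p ^ 4 = 1) :
    Commute (diagSL p hp) (upperSL (ZMod (2 ^ 4))) := by
  apply Matrix.SpecialLinearGroup.eq_of_coe_eq
  revert p
  decide +kernel

theorem diagSL_commute_lower (p : ZMod (2 ^ 4)) (hp : p ^ 4 = 1) :
    Commute (diagSL p hp) (lowerSL (ZMod (2 ^ 4))) := by
  apply Matrix.SpecialLinearGroup.eq_of_coe_eq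
  revert p
  decide +kernel

theorem upperSL_commute_commutator :
    Commute (upperSL (ZMod (2 ^ 4))) ⁅upperSL (ZMod (2 ^ 4)), lowerSL (ZMod (2 ^ 4))⁆ := by
  apply Matrix.SpecialLinearGroup.eq_of_coe_eq
  decide +kernel

theorem lowerSL_commute_commutator :
    Commute (lowerSL (ZMod (2 ^ 4))) ⁅upperSL (ZMod (2 ^ 4)), lowerSL (ZMod (2 ^ 4))⁆ := by
  apply Matrix.SpecialLinearGroup.eq_of_coe_eq
  decide +kernel

theorem commutator_closure_gammaGenerators_le :
    ⁅Subgroup.closure gammaGenerators, Subgroup.closure gammaGenerators⁆ ≤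
      Subgroup.zpowers ⁅upperSL (ZMod (2 ^ 4)), lowerSL (ZMod (2 ^ 4))⁆ := by
  have mem_of_commute {x y : Matrix.SpecialLinearGroup (Fin 2) (ZMod (2 ^ 4))} (h : Commute x y) :
      ⁅x, y⁆ ∈ Subgroup.zpowers ⁅upperSL (ZMod (2 ^ 4)), lowerSL (ZMod (2 ^ 4))⁆ := by
    rw [commutatorElement_eq_one_iff_commute.2 h]
    exact one_mem _
  apply Subgroup.commutator_closure_le_of_commute
  · rintro s hs _ ⟨k, rfl⟩
    suffices h : Commute s ⁅upperSL (ZMod (2 ^ 4)), lowerSL (ZMod (2 ^ 4))⁆ from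
      (h.zpow_right k).eq
    rcases hs with (rfl | rfl) | ⟨p, hp, rfl⟩
    · exact upperSL_commute_commutator
    · exact lowerSL_commute_commutator
    · have hu := diagSL_commute_upper p hp
      have hl := diagSL_commute_lower p hp
      rw [commutatorElement_def]
      exact ((hu.mul_right hl).mul_right hu.inv_right).mul_right hl.inv_right
  · rintro s ((rfl | rfl) | ⟨p, hp, rfl⟩) t ((rfl | rfl) | ⟨q, hq, rfl⟩)
    · exact mem_of_commute (Commute.refl (upperSL (ZMod (2 ^ 4))))
    · exact Subgroup.mem_zpowers _
    · exact mem_of_commute (diagSL_commute_upper q hq).symm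
    · rw [← commutatorElement_inv (upperSL (ZMod (2 ^ 4)))]
      exact inv_mem (Subgroup.mem_zpowers _)
    · exact mem_of_commute (Commute.refl _)
    · exact mem_of_commute (diagSL_commute_lower q hq).symm
    · exact mem_of_commute (diagSL_commute_upper p hp)
    · exact mem_of_commute (diagSL_commute_lower p hp)
    · exact mem_of_commute (diagSL_commute p q hp hq)

theorem orderOf_commutator_upperSL_lowerSL :
    orderOf ⁅upperSL (ZMod (2 ^ 4)), lowerSL (ZMod (2 ^ 4))⁆ = 4 := by
  have h2 : ¬ ⁅upperSL (ZMod (2 ^ 4)), lowerSL (ZMod (2 ^ 4))⁆ ^ 2 ^ 1 = 1 := fun h =>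
    absurd (congrArg Subtype.val h) (by decide +kernel)
  have h4 : ⁅upperSL (ZMod (2 ^ 4)), lowerSL (ZMod (2 ^ 4))⁆ ^ 2 ^ (1 + 1) = 1 :=
    Matrix.SpecialLinearGroup.eq_of_coe_eq (by decide +kernel)
  exact orderOf_eq_prime_pow h2 h4

theorem mem_closure_gammaGenerators {g : Matrix.SpecialLinearGroup (Fin 2) (ZMod (2 ^ 4))}
    (h00 : g 0 0 ^ 4 = 1) (h01 : ∃ j, g 0 1 = 2 * j) (h10 : ∃ i, g 1 0 = 2 * i) :
    g ∈ Subgroup.closure gammaGenerators := by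
  obtain ⟨j, hj⟩ := h01
  obtain ⟨i, hi⟩ := h10
  rw [eq_lowerSL_mul_diagSL_mul_upperSL h00 hi hj (ZMod.natCast_zmod_val (i * g 0 0 ^ 3))
    (ZMod.natCast_zmod_val (-j * g 0 0 ^ 3))]
  refine mul_mem (mul_mem (pow_mem ?_ _) ?_) (pow_mem ?_ _) <;> apply Subgroup.subset_closure
  · exact .inl (.inr rfl)
  · exact .inr ⟨_, _, rfl⟩
  · exact .inl (.inl rfl)

theorem map_gammaSL_one_le :
    (GammaSL 1).map (Matrix.SpecialLinearGroup.map (PadicInt.toZModPow 4)) ≤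
      Subgroup.closure gammaGenerators := by
  rintro _ ⟨g, hg, rfl⟩
  have hcast (a b : Fin 2) : (ZMod.cast (PadicInt.toZModPow 4 (g a b)) : ZMod (2 ^ 1)) =
      (1 : Matrix (Fin 2) (Fin 2) (ZMod (2 ^ 1))) a b := by
    rw [PadicInt.cast_toZModPow 1 4 (by norm_num)]
    exact apply_eq_of_map_eq_one hg a b
  have odd : ∀ x : ZMod (2 ^ 4), (ZMod.cast x : ZMod (2 ^ 1)) = 1 → x ^ 4 = 1 := by
    decide +kernel
  have even : ∀ x : ZMod (2 ^ 4), (ZMod.cast x : ZMod (2 ^ 1)) = 0 → ∃ j, x = 2 * j := by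
    decide +kernel
  exact mem_closure_gammaGenerators (odd _ (hcast 0 0)) (even _ (hcast 0 1)) (even _ (hcast 1 0))

/-- The image of the commutator subgroup of `Γ(2)` under the reduction map
`SL₂(ℤ₂) → SL₂(ℤ/16ℤ)` equals the cyclic subgroup generated by the image of the
commutator `στσ⁻¹τ⁻¹`, and this cyclic subgroup has order `4`. -/
theorem stmt14 (σ τ : Matrix.SpecialLinearGroup (Fin 2) ℤ_[2])
    (hσ : (σ : Matrix (Fin 2) (Fin 2) ℤ_[2]) = !![1, -2; 0, 1])
    (hτ : (τ : Matrix (Fin 2) (Fin 2) ℤ_[2]) = !![1, 0; 2, 1]) :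
    Subgroup.map (Matrix.SpecialLinearGroup.map (PadicInt.toZModPow 4))
        (Subgroup.map (GammaSL 1).subtype (commutator ↥(GammaSL 1))) =
      Subgroup.zpowers
        (Matrix.SpecialLinearGroup.map (PadicInt.toZModPow 4) (σ * τ * σ⁻¹ * τ⁻¹)) ∧
    orderOf (Matrix.SpecialLinearGroup.map (PadicInt.toZModPow 4) (σ * τ * σ⁻¹ * τ⁻¹)) = 4 := by
  have hσ1 : σ ∈ GammaSL 1 :=
    (map_eq_upperSL _ hσ).trans (Matrix.SpecialLinearGroup.eq_of_coe_eq (by decide +kernel))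
  have hτ1 : τ ∈ GammaSL 1 :=
    (map_eq_lowerSL _ hτ).trans (Matrix.SpecialLinearGroup.eq_of_coe_eq (by decide +kernel))
  have hσ4 : Matrix.SpecialLinearGroup.map (PadicInt.toZModPow 4) σ = upperSL (ZMod (2 ^ 4)) :=
    map_eq_upperSL _ hσ
  have hτ4 : Matrix.SpecialLinearGroup.map (PadicInt.toZModPow 4) τ = lowerSL (ZMod (2 ^ 4)) :=
    map_eq_lowerSL _ hτ
  have hcomm : Subgroup.map (GammaSL 1).subtype (commutator (GammaSL 1)) =
      ⁅GammaSL 1, GammaSL 1⁆ := Subgroup.map_subtype_commutator _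
  rw [hcomm, ← commutatorElement_def, map_commutatorElement, hσ4, hτ4]
  refine ⟨le_antisymm ?_ ?_, orderOf_commutator_upperSL_lowerSL⟩
  · rw [Subgroup.map_commutator]
    exact (Subgroup.commutator_mono map_gammaSL_one_le map_gammaSL_one_le).trans
      commutator_closure_gammaGenerators_le
  · rw [Subgroup.zpowers_le, ← hσ4, ← hτ4, ← map_commutatorElement]
    exact Subgroup.mem_map_of_mem _ (Subgroup.commutator_mem_commutator hσ1 hτ1)
end
end

section
/- The images of σ and of τ under the abelianization map Γ(2) → Γ(2)^{ab} each have order 8. -/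
set_option synthInstance.maxHeartbeats 400000
set_option maxHeartbeats 1000000

noncomputable section

theorem two_dvd_iff_toZModPow_one (x : ℤ_[2]) : 2 ∣ x ↔ PadicInt.toZModPow 1 x = 0 := by
  rw [← RingHom.mem_ker, PadicInt.ker_toZModPow, Ideal.mem_span_singleton]
  simp

theorem two_dvd_of_mem_GammaSL_one {A : Matrix.SpecialLinearGroup (Fin 2) ℤ_[2]}
    (hA : A ∈ GammaSL 1) : 2 ∣ A 0 0 - 1 ∧ 2 ∣ A 0 1 ∧ 2 ∣ A 1 0 := by
  have h (i j : Fin 2) : PadicInt.toZModPow 1 (A i j) = (1 : Matrix (Fin 2) (Fin 2) _) i j := by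
    have := congrArg (fun B : Matrix.SpecialLinearGroup (Fin 2) (ZMod (2 ^ 1)) => B i j)
      (MonoidHom.mem_ker.mp hA)
    simpa using this
  simp only [two_dvd_iff_toZModPow_one, map_sub, map_one, h]
  simp

theorem two_dvd_mul_add_one (x : ℤ_[2]) : 2 ∣ x * (x + 1) := by
  rw [two_dvd_iff_toZModPow_one, map_mul, map_add, map_one]
  generalize PadicInt.toZModPow 1 x = z
  revert z
  decide

theorem eight_dvd_sq_sub_one {a : ℤ_[2]} (ha : 2 ∣ a - 1) : 8 ∣ a ^ 2 - 1 := by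
  obtain ⟨x, hx⟩ := ha
  obtain ⟨y, hy⟩  := two_dvd_mul_add_one x
  exact ⟨y, by linear_combination (a + 1 + 2 * x) * hx + 4 * hy⟩

/-- The function `(a, b) ↦ a (a + b) - 1` of the first row of a matrix in `Γ(2)` is additive
modulo `16`. -/
theorem sixteen_dvd_row_defect {a b a' b' c' d' : ℤ_[2]} (ha : 2 ∣ a - 1) (hb : 2 ∣ b)
    (ha' : 2 ∣ a' - 1) (hb' : 2 ∣ b') (hc' : 2 ∣ c') (hdet' : a' * d' - b' * c' = 1) :
    16 ∣ ((a * a' + b * c') * ((a * a' + b * c') + (a * b' + b * d')) - 1) -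
      ((a * (a + b) - 1) + (a' * (a' + b') - 1)) := by
  obtain ⟨g, hg⟩ := eight_dvd_sq_sub_one ha
  obtain ⟨g', hg'⟩ := eight_dvd_sq_sub_one ha'
  obtain ⟨x, hx⟩ := ha
  obtain ⟨x', hx'⟩ := ha'
  obtain ⟨β, rfl⟩ := hb
  obtain ⟨β', rfl⟩ := hb'
  obtain ⟨γ', rfl⟩ := hc'
  have hd' : a' * d' = 1 + 4 * β' * γ' := by linear_combination hdet'
  obtain ⟨y, hy⟩  := two_dvd_mul_add_one β
  obtain ⟨w, hw⟩ : 2 ∣ d' - 1 := ⟨2 * β' * γ' - x' * d', by linear_combination hd' - d' * hx'⟩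
  exact ⟨4 * g * g' + β ^ 2 * γ' ^ 2 + g * a' * β' + a * β * β' * γ' +
      γ' * (y + β * (x + x' + 2 * x * x' + β * w)), by
    linear_combination (a' ^ 2 - 1 + 2 * a' * β') * hg + 8 * g * hg' + 2 * a * β * hd' +
      8 * γ' * hy + 8 * β * γ' * (a' * hx + (1 + 2 * x) * hx') + 8 * β ^ 2 * γ' * hw⟩

theorem toZModPow_four_eq_iff (x y : ℤ_[2]) :
    PadicInt.toZModPow 4 x = PadicInt.toZModPow 4 y ↔ 16 ∣ x - y := by
  rw [← sub_eq_zero, ← map_sub, ← RingHom.mem_ker, PadicInt.ker_toZModPow,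
    Ideal.mem_span_singleton]
  norm_num

/-- The character `A ↦ a (a + b) - 1` of `Γ(2)` with values in `ℤ/16ℤ`. -/
def upperCharacter : GammaSL 1 →* Multiplicative (ZMod (2 ^ 4)) :=
  MonoidHom.mk' (fun A => .ofAdd (PadicInt.toZModPow 4 (A.1 0 0 * (A.1 0 0 + A.1 0 1) - 1)))
    fun A B => by
      obtain ⟨ha, hb, -⟩ := two_dvd_of_mem_GammaSL_one A.2
      obtain ⟨ha', hb', hc'⟩ := two_dvd_of_mem_GammaSL_one B.2
      have hdet := B.1.det_coe
      rw [Matrix.det_fin_two] at hdet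
      have key := sixteen_dvd_row_defect ha hb ha' hb' hc' hdet
      rw [← ofAdd_add, ← map_add]
      congr 1
      rw [← toZModPow_four_eq_iff] at key
      simpa [Matrix.mul_apply, Fin.sum_univ_two] using key

/-- The character `A ↦ a (a + c) - 1` of `Γ(2)` with values in `ℤ/16ℤ`. -/
def lowerCharacter : GammaSL 1 →* Multiplicative (ZMod (2 ^ 4)) :=
  MonoidHom.mk' (fun A => .ofAdd (PadicInt.toZModPow 4 (A.1 0 0 * (A.1 0 0 + A.1 1 0) - 1)))
    fun A B => by
      obtain ⟨ha, hb, hc⟩ := two_dvd_of_mem_GammaSL_one A.2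
      obtain ⟨ha', -, hc'⟩ := two_dvd_of_mem_GammaSL_one B.2
      have hdet := A.1.det_coe
      rw [Matrix.det_fin_two, mul_comm (A.1.1 0 1)] at hdet
      have key := sixteen_dvd_row_defect ha' hc' ha hc hb hdet
      rw [← ofAdd_add, ← map_add]
      congr 1
      rw [← toZModPow_four_eq_iff, add_comm (B.1.1 0 0 * _ - 1)] at key
      simpa [Matrix.mul_apply, Fin.sum_univ_two, mul_comm, add_comm] using key

theorem Abelianization.of_eq_of_semiconjBy {G : Type*} [Group G] {h x y : G}
    (hxy : SemiconjBy h x y) : Abelianization.of x = Abelianization.of y := by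
  have := congrArg Abelianization.of hxy.eq
  rw [map_mul, map_mul, mul_comm] at this
  exact mul_right_cancel this

theorem Abelianization.orderOf_of_eq_eight {G H : Type*} [Group G] [CommGroup H] {x : G}
    (hx : Abelianization.of (x ^ 9) = Abelianization.of x) (f : G →* H) (hf : f x ^ 4 ≠ 1) :
    orderOf (Abelianization.of x) = 8 := by
  refine orderOf_eq_prime_pow (p := 2) (n := 2) (fun h => hf ?_) ?_
  · simpa using congrArg (Abelianization.lift f) h
  · rw [map_pow, pow_succ] at hx
    exact mul_eq_right.mp hx

theorem exists_diagonal_mem_GammaSL_one : ∃ (h : GammaSL 1) (u : ℤ_[2]), 3 * u = 1 ∧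
    (h : Matrix.SpecialLinearGroup (Fin 2) ℤ_[2]).1 = !![3, 0; 0, u] := by
  obtain ⟨u, hu⟩ : ∃ u : ℤ_[2], 3 * u = 1 := by
    have h3 : IsUnit (3 : ℤ_[2]) := by
      rw [PadicInt.isUnit_iff]
      exact_mod_cast (PadicInt.norm_natCast_eq_one_iff (p := 2) (n := 3)).mpr (by decide)
    exact h3.exists_right_inv
  obtain ⟨A, hA⟩ : ∃ A : Matrix.SpecialLinearGroup (Fin 2) ℤ_[2], A.1 = !![3, 0; 0, u] :=
    ⟨⟨_, by simp [Matrix.det_fin_two, hu]⟩, rfl⟩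
  refine ⟨⟨A, MonoidHom.mem_ker.mpr (Matrix.SpecialLinearGroup.ext _ _ fun i j => ?_)⟩, u, hu, hA⟩
  have h3 : PadicInt.toZModPow 1 (3 : ℤ_[2]) = 1 := (map_ofNat _ 3).trans (by decide)
  have hu' := congrArg (PadicInt.toZModPow 1) hu
  rw [map_mul, map_one, h3, one_mul] at hu'
  fin_cases i <;> fin_cases j <;> simp [hA, hu', h3]

/-- The images of `σ = [[1, -2], [0, 1]]` and of `τ = [[1, 0], [2, 1]]` under the
abelianization map `Γ(2) → Γ(2)^{ab}` each have order `8`. -/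
theorem stmt15 (σ τ : Matrix.SpecialLinearGroup (Fin 2) ℤ_[2])
    (hσ : (σ : Matrix (Fin 2) (Fin 2) ℤ_[2]) = !![1, -2; 0, 1])
    (hτ : (τ : Matrix (Fin 2) (Fin 2) ℤ_[2]) = !![1, 0; 2, 1])
    (hσ1 : σ ∈ GammaSL 1) (hτ1 : τ ∈ GammaSL 1) :
    orderOf (Abelianization.of (⟨σ, hσ1⟩ : ↥(GammaSL 1))) = 8 ∧
      orderOf (Abelianization.of (⟨τ, hτ1⟩ : ↥(GammaSL 1))) = 8 := by
  obtain ⟨h, u, hu, hh⟩ := exists_diagonal_mem_GammaSL_one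
  constructor
  · refine Abelianization.orderOf_of_eq_eight
      (Abelianization.of_eq_of_semiconjBy (h := h) ?_).symm upperCharacter ?_
    · refine Subtype.ext (Subtype.ext ?_)
      simp [hh, hσ, pow_succ]
      linear_combination 6 * hu
    · simp only [upperCharacter, MonoidHom.mk'_apply, hσ]
      simp
      rw [map_ofNat]
      decide
  · refine Abelianization.orderOf_of_eq_eight
      (Abelianization.of_eq_of_semiconjBy (h := h) ?_) lowerCharacter ?_
    · refine Subtype.ext (Subtype.ext ?_)
      simp [hh, hτ, pow_succ]
      linear_combination 6 * hu
    · simp only [lowerCharacter, MonoidHom.mk'_apply, hτ]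
      simp
      rw [map_ofNat]
      decide
end
end

section
/- The extension K₁({r_{ij} : 1 ≤ i < j ≤ d}) / K₁ is Galois of degree N^{d(d−1)/2}, with Galois group isomorphic to (ℤ/Nℤ)^{d(d−1)/2}. -/
set_option synthInstance.maxHeartbeats 400000
set_option maxHeartbeats 1000000

noncomputable section

/-- `K₁ = ℂ(t₁, ..., t_d)`, the field of rational functions in `d` independent variables
over `ℂ`. -/
abbrev KFd (d : ℕ) : Type := FractionRing (MvPolynomial (Fin d) ℂ)

/-- `Ω`, a fixed algebraic closure of `K₁`. -/
abbrev OMd (d : ℕ) : Type := AlgebraicClosure (KFd d)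

/-- The variables `t₁, ..., t_d`, viewed inside `Ω`. -/
def Td (d : ℕ) (i : Fin d) : OMd d :=
  algebraMap (KFd d) (OMd d)
    (algebraMap (MvPolynomial (Fin d) ℂ) (KFd d) (MvPolynomial.X i))

noncomputable instance (d : ℕ) (M : IntermediateField (KFd d) (OMd d)) :
    Algebra (KFd d) ↥M :=
  inferInstanceAs (Algebra (KFd d) ↥M.toSubalgebra)

section KummerTheory

variable {K L : Type*} [Field K] [Field L] [Algebra K L]

/-- If `K` contains a primitive `N`-th root of unity, `K`-automorphisms of `L` fix
all `N`-th roots of unity of `L`. -/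
lemma IsPrimitiveRoot.algEquiv_apply_eq_of_pow_eq_one {N : ℕ} [NeZero N] {ζ : K}
    (hζ : IsPrimitiveRoot ζ N) {x : L} (hx : x ^ N = 1) (σ : L ≃ₐ[K] L) : σ x = x := by
  obtain ⟨k, -, rfl⟩ :=
    (hζ.map_of_injective (algebraMap K L).injective).eq_pow_of_pow_eq_one hx
  simp

/-- The Kummer character `σ ↦ σ b / b` attached to an element `b` whose `N`-th power lies in
the base field. -/
def kummerCharacter {N : ℕ} [NeZero N] {ζ : K} (hζ : IsPrimitiveRoot ζ N) {a : K} {b : L}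
    (hb : b ≠ 0) (hab : b ^ N = algebraMap K L a) : (L ≃ₐ[K] L) →* rootsOfUnity N L :=
  have hpow (σ : L ≃ₐ[K] L) : (σ b / b) ^ N = 1 := by
    rw [div_pow, ← map_pow, hab, AlgEquiv.commutes, ← hab, div_self (pow_ne_zero N hb)]
  { toFun := fun σ ↦ rootsOfUnity.mkOfPowEq (σ b / b) (hpow σ)
    map_one' := by
      ext
      simp [hb]
    map_mul' := fun σ τ ↦ by
      ext
      have hfix := hζ.algEquiv_apply_eq_of_pow_eq_one (hpow τ) σ
      have hσ : σ b ≠ 0 := by simpa using hb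
      rw [map_div₀] at hfix
      simp only [AlgEquiv.mul_apply, rootsOfUnity.coe_mkOfPowEq, Subgroup.coe_mul,
        Units.val_mul, ← hfix]
      field_simp }

lemma coe_kummerCharacter {N : ℕ} [NeZero N] {ζ : K} (hζ : IsPrimitiveRoot ζ N) {a : K} {b : L}
    (hb : b ≠ 0) (hab : b ^ N = algebraMap K L a) (σ : L ≃ₐ[K] L) :
    ((kummerCharacter hζ hb hab σ : Lˣ) : L) = σ b / b := by
  simp [kummerCharacter]

/-- Multi-Kummer theory: adjoining `N`-th roots of elements that are multiplicatively independent
modulo `N`-th powers gives the full group of tuples of roots of unity. -/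
theorem nonempty_algEquiv_mulEquiv_pi_rootsOfUnity [FiniteDimensional K L] [IsGalois K L]
    {N : ℕ} [NeZero N] {ζ : K} (hζ : IsPrimitiveRoot ζ N) {I : Type*} [Fintype I]
    (a : I → K) (s : I → L) (ha : ∀ i, a i ≠ 0) (hs : ∀ i, s i ^ N = algebraMap K L (a i))
    (hgen : IntermediateField.adjoin K (Set.range s) = ⊤)
    (hindep : ∀ (e e' : I → Fin N) (b : K),
      ∏ i, a i ^ (e i : ℕ) = b ^ N * ∏ i, a i ^ (e' i : ℕ) → e = e') :
    Nonempty ((L ≃ₐ[K] L) ≃* (I → rootsOfUnity N L)) := by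
  have hs0 (i : I) : s i ≠ 0 := by
    intro h
    have := hs i
    rw [h, zero_pow (NeZero.ne N)] at this
    exact ha i (by simpa using this.symm)
  let φ : (L ≃ₐ[K] L) →* (I → rootsOfUnity N L) :=
    MonoidHom.pi fun i ↦ kummerCharacter hζ (hs0 i) (hs i)
  have hφ (σ : L ≃ₐ[K] L) (i : I) : ((φ σ i : Lˣ) : L) = σ (s i) / s i :=
    coe_kummerCharacter hζ (hs0 i) (hs i) σ
  have hinj : Function.Injective φ := by
    intro σ τ h
    ext x
    have hx : x ∈ IntermediateField.adjoin K (Set.range s) := hgen ▸ IntermediateField.mem_top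
    induction hx using IntermediateField.adjoin_induction with
    | mem x hx =>
      obtain ⟨i, rfl⟩ := hx
      have := hφ σ i
      rw [h, hφ τ i, div_left_inj' (hs0 i)] at this
      exact this.symm
    | algebraMap x => simp
    | add x y _ _ hx hy => rw [map_add, map_add, hx, hy]
    | inv x _ hx => rw [map_inv₀, map_inv₀, hx]
    | mul x y _ _ hx hy => rw [map_mul, map_mul, hx, hy]
  let χ (e : I → Fin N) : (L ≃ₐ[K] L) →* L :=
    ((Units.coeHom L).comp (rootsOfUnity N L).subtype).comp
      ((∏ i, Pi.evalMonoidHom (fun _ : I ↦ rootsOfUnity N L) i ^ (e i : ℕ)).comp φ)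
  have hχ (e : I → Fin N) (σ : L ≃ₐ[K] L) :
      χ e σ = σ (∏ i, s i ^ (e i : ℕ)) / ∏ i, s i ^ (e i : ℕ) := by
    simp [χ, MonoidHom.finsetProd_apply, hφ, div_pow, Finset.prod_div_distrib, map_prod]
  have hm0 (e : I → Fin N) : ∏ i, s i ^ (e i : ℕ) ≠ 0 :=
    Finset.prod_ne_zero_iff.mpr fun i _ ↦ pow_ne_zero _ (hs0 i)
  have hmpow (e : I → Fin N) :
      (∏ i, s i ^ (e i : ℕ)) ^ N = algebraMap K L (∏ i, a i ^ (e i : ℕ)) := by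
    simp only [← Finset.prod_pow, map_prod, map_pow, ← hs, ← pow_mul, mul_comm]
  have hχinj : Function.Injective χ := by
    intro e e' h
    have hfix : ∀ σ : L ≃ₐ[K] L, σ ((∏ i, s i ^ (e i : ℕ)) / ∏ i, s i ^ (e' i : ℕ)) =
        (∏ i, s i ^ (e i : ℕ)) / ∏ i, s i ^ (e' i : ℕ) := by
      intro σ
      have h₁ := DFunLike.congr_fun h σ
      rw [hχ, hχ, div_eq_div_iff (hm0 e) (hm0 e')] at h₁
      rw [map_div₀, div_eq_div_iff ((map_ne_zero σ).mpr (hm0 e')) (hm0 e'), h₁, mul_comm]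
    obtain ⟨b, hb⟩ := IntermediateField.mem_bot.mp ((IsGalois.mem_bot_iff_fixed _).mpr hfix)
    refine hindep e e' b ((algebraMap K L).injective ?_)
    rw [map_mul, map_pow, hb, ← hmpow, ← hmpow, div_pow,
      div_mul_cancel₀ _ (pow_ne_zero N (hm0 e'))]
  have hlin := (linearIndependent_monoidHom (L ≃ₐ[K] L) L).comp χ hχinj
  classical
  have hcard := hlin.fintype_card_le_finrank
  have hN : Nat.card (rootsOfUnity N L) = N :=
    (hζ.map_of_injective (algebraMap K L).injective).card_rootsOfUnity
  have hle : Nat.card (I → rootsOfUnity N L) ≤ Nat.card (L ≃ₐ[K] L) := by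
    rw [Nat.card_pi]
    simpa only [hN, Finset.prod_const, Finset.card_univ, Fintype.card_pi, Fintype.card_fin,
      Module.finrank_fintype_fun_eq_card, Nat.card_eq_fintype_card] using hcard
  exact ⟨MulEquiv.ofBijective φ (hinj.bijective_of_nat_card_le hle)⟩

/-- A field generated by `N`-th roots of elements of a field containing a primitive `N`-th root
of unity is normal. -/
lemma normal_adjoin_range_of_pow_eq {Ω : Type*} [Field Ω] [Algebra K Ω] [Normal K Ω]
    {N : ℕ} [NeZero N] {ζ : K} (hζ : IsPrimitiveRoot ζ N) {I : Type*}
    (a : I → K) (s : I → Ω) (hs : ∀ i, s i ^ N = algebraMap K Ω (a i)) :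
    Normal K (IntermediateField.adjoin K (Set.range s)) := by
  rw [IntermediateField.normal_iff_forall_map_le]
  intro σ
  rw [IntermediateField.adjoin_map, IntermediateField.adjoin_le_iff]
  rintro _ ⟨_, ⟨i, rfl⟩, rfl⟩
  have hmem : s i ∈ IntermediateField.adjoin K (Set.range s) :=
    IntermediateField.subset_adjoin _ _ ⟨i, rfl⟩
  by_cases h0 : s i = 0
  · simp [h0]
  · have hpow : (σ (s i) / s i) ^ N = 1 := by
      rw [div_pow, ← map_pow, hs, AlgHom.commutes, ← hs, div_self (pow_ne_zero N h0)]
    obtain ⟨k, -, hk⟩ :=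
      (hζ.map_of_injective (algebraMap K Ω).injective).eq_pow_of_pow_eq_one hpow
    have hσ : σ (s i) = algebraMap K Ω (ζ ^ k) * s i := by
      rw [map_pow, hk, div_mul_cancel₀ _ h0]
    exact hσ ▸ mul_mem (IntermediateField.algebraMap_mem _ _) hmem

theorem isGalois_finrank_nonempty_mulEquiv_adjoin_range {Ω : Type*} [Field Ω] [Algebra K Ω]
    [Normal K Ω] [CharZero K] {N : ℕ} [NeZero N] {ζ : K} (hζ : IsPrimitiveRoot ζ N)
    {I : Type*} [Fintype I] (a : I → K) (s : I → Ω) (ha : ∀ i, a i ≠ 0)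
    (hs : ∀ i, s i ^ N = algebraMap K Ω (a i))
    (hindep : ∀ (e e' : I → Fin N) (b : K),
      ∏ i, a i ^ (e i : ℕ) = b ^ N * ∏ i, a i ^ (e' i : ℕ) → e = e')
    {m : ℕ} (hm : Fintype.card I = m)
    (M : IntermediateField K Ω) (hM : M = IntermediateField.adjoin K (Set.range s)) :
    IsGalois K M ∧ Module.finrank K M = N ^ m ∧
      Nonempty ((M ≃ₐ[K] M) ≃* Multiplicative (Fin m → ZMod N)) := by
  have hmem (i : I) : s i ∈ M := hM ▸ IntermediateField.subset_adjoin _ _ ⟨i, rfl⟩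
  have : Normal K M := hM ▸ normal_adjoin_range_of_pow_eq hζ a s hs
  have : FiniteDimensional K M := by
    rw [hM]
    exact IntermediateField.finiteDimensional_adjoin fun x _ ↦ Normal.isIntegral ‹Normal K Ω› x
  have hgal : IsGalois K M := { }
  let s' (i : I) : M := ⟨s i, hmem i⟩
  have hgen : IntermediateField.adjoin K (Set.range s') = ⊤ := by
    apply IntermediateField.lift_injective M
    rw [IntermediateField.lift_adjoin, IntermediateField.lift_top, ← Set.range_comp]
    exact hM.symm
  obtain ⟨f⟩ := nonempty_algEquiv_mulEquiv_pi_rootsOfUnity hζ a s' ha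
    (fun i ↦ Subtype.ext (hs i)) hgen hindep
  have hN : Nat.card (rootsOfUnity N M) = N :=
    (hζ.map_of_injective (algebraMap K M).injective).card_rootsOfUnity
  let g : rootsOfUnity N M ≃* Multiplicative (ZMod N) :=
    mulEquivOfCyclicCardEq (hN.trans (Nat.card_zmod N).symm)
  let h : (I → rootsOfUnity N M) ≃* (Fin m → Multiplicative (ZMod N)) :=
    (MulEquiv.piCongrRight fun _ ↦ g).trans
      (MulEquiv.arrowCongr (Fintype.equivFinOfCardEq hm) (MulEquiv.refl _))
  let k : (Fin m → Multiplicative (ZMod N)) ≃* Multiplicative (Fin m → ZMod N) :=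
    { toFun := fun x ↦ Multiplicative.ofAdd fun i ↦ (x i).toAdd
      invFun := fun x i ↦ Multiplicative.ofAdd (x.toAdd i)
      left_inv := fun _ ↦ rfl
      right_inv := fun _ ↦ rfl
      map_mul' := fun _ _ ↦ rfl }
  refine ⟨hgal, ?_, ⟨(f.trans h).trans k⟩⟩
  rw [← IsGalois.card_aut_eq_finrank, Nat.card_congr (f.trans h).toEquiv, Nat.card_pi]
  simp

end KummerTheory

/-- Pairwise non-associated primes of a domain with well-founded divisibility are
multiplicatively independent modulo
`N`-th powers in its field of fractions. -/
lemma eq_of_prod_pow_eq_pow_mul_prod_pow {R K : Type*} [CommRing R] [IsDomain R]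
    [WfDvdMonoid R] [Field K] [Algebra R K] [IsFractionRing R K] {I : Type*} [Fintype I]
    (p : I → R) (hp : ∀ i, Prime (p i)) (hdvd : ∀ i j, p i ∣ p j → i = j) {N : ℕ}
    (e e' : I → Fin N) (b : K)
    (h : ∏ i, algebraMap R K (p i) ^ (e i : ℕ) =
      b ^ N * ∏ i, algebraMap R K (p i) ^ (e' i : ℕ)) : e = e' := by
  classical
  obtain ⟨x, y, hy, rfl⟩ := IsFractionRing.div_surjective (A := R) b
  have hy0 : y ≠ 0 := nonZeroDivisors.ne_zero hy
  have hyK : algebraMap R K y ≠ 0 := by simpa using hy0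
  have hR : y ^ N * ∏ i, p i ^ (e i : ℕ) = x ^ N * ∏ i, p i ^ (e' i : ℕ) := by
    apply IsFractionRing.injective R K
    simp only [map_mul, map_pow, map_prod, h]
    rw [← mul_assoc, ← mul_pow, mul_div_cancel₀ _ hyK]
  funext i
  have hN0 : N ≠ 0 := (Fin.pos (e i)).ne'
  have hx0 : x ≠ 0 := by
    rintro rfl
    rw [zero_pow hN0, zero_mul] at hR
    exact mul_ne_zero (pow_ne_zero N hy0)
      (Finset.prod_ne_zero_iff.mpr fun j _ ↦ pow_ne_zero _ (hp j).ne_zero) hR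
  have hprod (c : I → Fin N) : emultiplicity (p i) (∏ j, p j ^ (c j : ℕ)) = (c i : ℕ) := by
    rw [Finset.emultiplicity_prod (hp i), Finset.sum_eq_single i]
    · exact emultiplicity_pow_self_of_prime (hp i) _
    · intro j _ hji
      rw [emultiplicity_pow (hp i),
        emultiplicity_eq_zero.mpr fun hd ↦ hji (hdvd i j hd).symm, mul_zero]
    · simp
  have hval := congrArg (emultiplicity (p i)) hR
  have hfin {z : R} (hz : z ≠ 0) : FiniteMultiplicity (p i) z :=
    FiniteMultiplicity.of_prime_left (hp i) hz
  rw [emultiplicity_mul (hp i), emultiplicity_mul (hp i), hprod, hprod,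
    emultiplicity_pow (hp i), emultiplicity_pow (hp i),
    (hfin hx0).emultiplicity_eq_multiplicity, (hfin hy0).emultiplicity_eq_multiplicity] at hval
  have hnat : N * multiplicity (p i) y + (e i : ℕ) = N * multiplicity (p i) x + (e' i : ℕ) := by
    exact_mod_cast hval
  have hmod := congrArg (· % N) hnat
  simp only [Nat.mul_add_mod, Nat.mod_eq_of_lt (e i).isLt, Nat.mod_eq_of_lt (e' i).isLt] at hmod
  exact Fin.ext hmod

namespace MvPolynomial

variable {σ F : Type*} [Field F]

lemma prime_X_sub_X {i j : σ} (hij : i ≠ j) : Prime (X j - X i : MvPolynomial σ F) := by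
  classical
  have hcoeff : coeff (Finsupp.single j 1) (X j - X i : MvPolynomial σ F) = 1 := by
    simp [coeff_X, hij, Finsupp.single_left_inj]
  refine (irreducible_of_totalDegree_eq_one (le_antisymm ?_ ?_) ?_).prime
  · exact (totalDegree_sub _ _).trans (by simp)
  · refine le_trans ?_ (le_totalDegree (s := Finsupp.single j 1) ?_)
    · simp
    · simp [mem_support_iff, hcoeff]
  · intro x hx
    exact isUnit_of_dvd_one (hcoeff ▸ hx _)

lemma mem_pair_of_X_sub_X_dvd {i j k l : σ} (hkl : k ≠ l)
    (h : (X j - X i : MvPolynomial σ F) ∣ X l - X k) : (k = i ∨ k = j) ∧ (l = i ∨ l = j) := by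
  classical
  obtain ⟨q, hq⟩ := h
  constructor
  · by_contra! hk
    simpa [hk.1.symm, hk.2.symm, hkl.symm] using
      congrArg (eval (Pi.single k (1 : F))) hq
  · by_contra! hl
    simpa [hl.1.symm, hl.2.symm, hkl] using
      congrArg (eval (Pi.single l (1 : F))) hq

end MvPolynomial

/-- For `d ≥ 2`, `N ≥ 1` and fixed `N`-th roots `r_{ij}` of `t_j - t_i` in `Ω` for
`1 ≤ i < j ≤ d`, the extension `K₁({r_{ij}}) / K₁` is Galois of degree `N^{d(d-1)/2}`,
with Galois group isomorphic to `(ℤ/Nℤ)^{d(d-1)/2}`. -/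
theorem stmt16 (d N : ℕ) (hd : 2 ≤ d) (hN : 1 ≤ N)
    (r : Fin d → Fin d → OMd d) (hr : ∀ i j : Fin d, i < j → r i j ^ N = Td d j - Td d i)
    (L : IntermediateField (KFd d) (OMd d))
    (hL : L = IntermediateField.adjoin (KFd d) {x | ∃ i j : Fin d, i < j ∧ x = r i j}) :
    IsGalois (KFd d) ↥L ∧ Module.finrank (KFd d) ↥L = N ^ (d * (d - 1) / 2) ∧
      Nonempty ((↥L ≃ₐ[KFd d] ↥L) ≃* Multiplicative (Fin (d * (d - 1) / 2) → ZMod N)) := by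
  have : NeZero N := ⟨by lia⟩
  let I := Σ j : Fin d, Finset.Iio j
  let p (x : I) : MvPolynomial (Fin d) ℂ := MvPolynomial.X x.1 - MvPolynomial.X x.2.1
  have hlt (x : I) : x.2.1 < x.1 := Finset.mem_Iio.mp x.2.2
  have hp (x : I) : Prime (p x) := MvPolynomial.prime_X_sub_X (hlt x).ne
  have hdvd (x y : I) (h : p x ∣ p y) : x = y := by
    obtain ⟨h₁, h₂⟩ := MvPolynomial.mem_pair_of_X_sub_X_dvd (hlt y).ne h
    obtain ⟨j, i, hi⟩ := x
    obtain ⟨l, k, hk⟩ := y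
    simp only [Finset.mem_Iio] at hi hk
    obtain ⟨rfl, rfl⟩ : k = i ∧ l = j := by grind
    rfl
  have hcard : Fintype.card I = d * (d - 1) / 2 := by
    simp only [I, Fintype.card_sigma, Fintype.card_coe, Fin.card_Iio]
    rw [Fin.sum_univ_eq_sum_range (fun i ↦ i), Finset.sum_range_id]
  have hζ : IsPrimitiveRoot (algebraMap ℂ (KFd d) (Complex.exp (2 * Real.pi * Complex.I / N))) N :=
    (Complex.isPrimitiveRoot_exp N (NeZero.ne N)).map_of_injective (algebraMap ℂ (KFd d)).injective
  have hset : {x | ∃ i j : Fin d, i < j ∧ x = r i j} = Set.range fun x : I ↦ r x.2.1 x.1 := by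
    ext z
    constructor
    · rintro ⟨i, j, hij, rfl⟩
      exact ⟨⟨j, i, Finset.mem_Iio.mpr hij⟩, rfl⟩
    · rintro ⟨x, rfl⟩
      exact ⟨_, _, hlt x, rfl⟩
  exact isGalois_finrank_nonempty_mulEquiv_adjoin_range hζ
    (fun x : I ↦ algebraMap _ (KFd d) (p x)) (fun x : I ↦ r x.2.1 x.1)
    (fun x ↦ by simpa using (hp x).ne_zero)
    (fun x ↦ by simp [hr _ _ (hlt x), Td, p])
    (eq_of_prod_pow_eq_pow_mul_prod_pow p hp hdvd) hcard L (hset ▸ hL)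
end
end

section
/- Let d ≥ 6 and suppose elements v_{i,j} = v_{j,i} ∈ W, indexed by pairs of distinct i, j ∈ {1, ..., d}, satisfy: (i) σ · v_{i,j} = v_{σ(i),σ(j)} for every σ ∈ S_d; (ii) for each i, the set {v_{i,j}}_{j ≠ i} spans a subspace of dimension d − 2, and Σ_{j ≠ i} v_{i,j} = 0 is the unique nontrivial linear relation among the v_{i,j} for j ≠ i (i.e., a subset of {v_{i,j}}_{j ≠ i} sums to zero only if it is empty or all of them); (iii) v_{s,t} + v_{s,j} = v_{t,j} for all pairwise distinct s, t, j. Then for every i ≤ d − 1, v_{i,d} = Σ_{j ∉ {i,d}} (e_{{i,j}} + e_{{d,j}}). -/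
noncomputable section

/-- The index set of `2`-element subsets of `{1, ..., d}`. -/
abbrev PairIdx (d : ℕ) : Type := {S : Finset (Fin d) // S.card = 2}

/-- `W`, the `𝔽₂`-vector space with basis `{e_S}` indexed by the `2`-element subsets `S`
of `{1, ..., d}`. -/
abbrev Wsp (d : ℕ) : Type := PairIdx d → ZMod 2

/-- The action of a permutation on `2`-element subsets. -/
def permPair {d : ℕ} (σ : Equiv.Perm (Fin d)) (S : PairIdx d) : PairIdx d :=
  ⟨S.1.image σ, by rw [Finset.card_image_of_injective _ σ.injective, S.2]⟩

/-- The linear action of `S_d` on `W`, determined by `σ • e_S = e_{σ(S)}`. -/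
def act {d : ℕ} (σ : Equiv.Perm (Fin d)) (v : Wsp d) : Wsp d :=
  fun S => v (permPair σ⁻¹ S)

/-- The basis vector `e_S` of `W`. -/
def basisVec {d : ℕ} (S : PairIdx d) : Wsp d := Pi.single S 1

/-- The coefficient of `w` at the pair `{k, l}`, with value `0` when `k = l`. -/
def pairCoeff {d : ℕ} (w : Wsp d) (k l : Fin d) : ZMod 2 :=
  if h : k ≠ l then w ⟨{k, l}, Finset.card_pair h⟩ else 0

theorem pairCoeff_comm {d : ℕ} (w : Wsp d) (k l : Fin d) : pairCoeff w k l = pairCoeff w l k := by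
  unfold pairCoeff
  by_cases h : k = l
  · simp [h]
  · simp [h, Ne.symm h, Finset.pair_comm k l]

theorem pairCoeff_add {d : ℕ} (w w' : Wsp d) (k l : Fin d) :
    pairCoeff (w + w') k l = pairCoeff w k l + pairCoeff w' k l := by
  unfold pairCoeff
  split_ifs <;> simp

theorem pairCoeff_act {d : ℕ} (σ : Equiv.Perm (Fin d)) (w : Wsp d) (k l : Fin d) :
    pairCoeff (act σ w) (σ k) (σ l) = pairCoeff w k l := by
  by_cases h : k = l
  · simp [pairCoeff, h]
  · simp [pairCoeff, h, act, permPair, Finset.image_insert]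

theorem Wsp.ext_pairCoeff {d : ℕ} {w w' : Wsp d}
    (h : ∀ k l, k ≠ l → pairCoeff w k l = pairCoeff w' k l) : w = w' := by
  funext ⟨S, hS⟩
  obtain ⟨k, l, hkl, rfl⟩ := Finset.card_eq_two.mp hS
  simpa [pairCoeff, hkl] using h k l hkl

theorem pairCoeff_sum_star {d : ℕ} (i m k l : Fin d) (hkl : k ≠ l) :
    pairCoeff (∑ j ∈ ((Finset.univ.erase i).erase m).attach,
      (basisVec ⟨{i, j.1},
          Finset.card_pair (Ne.symm (Finset.ne_of_mem_erase (Finset.mem_of_mem_erase j.2)))⟩ +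
        basisVec ⟨{m, j.1}, Finset.card_pair (Ne.symm (Finset.ne_of_mem_erase j.2))⟩)) k l =
      ∑ j ∈ (Finset.univ.erase i).erase m,
        ((if ({k, l} : Finset (Fin d)) = {i, j} then 1 else 0) +
          (if ({k, l} : Finset (Fin d)) = {m, j} then 1 else 0)) := by
  rw [← Finset.sum_attach ((Finset.univ.erase i).erase m)]
  simp [pairCoeff, hkl, basisVec, Pi.single_apply]

theorem Finset.pair_eq_iff {α : Type*} [DecidableEq α] (a b c e : α) :
    ({a, b} : Finset α) = {c, e} ↔ a = c ∧ b = e ∨ a = e ∧ b = c := by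
  rw [← Finset.coe_inj]
  simpa using Set.pair_eq_pair_iff

theorem exists_notMem_of_card_lt {d : ℕ} {T : Finset (Fin d)} (hT : T.card < d) :
    ∃ s, s ∉ T := by
  by_contra! h
  rw [Finset.eq_univ_iff_forall.mpr h, Finset.card_univ, Fintype.card_fin] at hT
  exact hT.false

/-- A vector whose coefficients away from the star at `i` and `m` vanish, and are `1` on it,
is the sum of the basis vectors of the star. -/
theorem eq_sum_star {d : ℕ} {i m : Fin d} (him : i ≠ m) {w : Wsp d}
    (hmid : pairCoeff w i m = 0)
    (hout : ∀ k l, k ≠ l → k ≠ i → k ≠ m → l ≠ i → l ≠ m → pairCoeff w k l = 0)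
    (hleft : ∀ k, k ≠ i → k ≠ m → pairCoeff w i k = 1)
    (hright : ∀ k, k ≠ i → k ≠ m → pairCoeff w m k = 1) :
    w = ∑ j ∈ ((Finset.univ.erase i).erase m).attach,
      (basisVec ⟨{i, j.1},
          Finset.card_pair (Ne.symm (Finset.ne_of_mem_erase (Finset.mem_of_mem_erase j.2)))⟩ +
        basisVec ⟨{m, j.1}, Finset.card_pair (Ne.symm (Finset.ne_of_mem_erase j.2))⟩) := by
  refine Wsp.ext_pairCoeff fun k l hkl => ?_
  rw [pairCoeff_sum_star i m k l hkl]
  by_cases hk : k = i ∨ k = m <;> by_cases hl : l = i ∨ l = m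
  · rw [Finset.sum_eq_zero]
    · have := pairCoeff_comm w k l
      grind
    · intro j hj
      simp only [Finset.pair_eq_iff]
      grind
  · rw [Finset.sum_eq_single l]
    · simp only [Finset.pair_eq_iff]
      grind
    · intro j hj hjl
      simp only [Finset.pair_eq_iff]
      grind
    · grind
  · rw [Finset.sum_eq_single k, pairCoeff_comm]
    · simp only [Finset.pair_eq_iff]
      grind
    · intro j hj hjl
      simp only [Finset.pair_eq_iff]
      grind
    · grind
  · rw [Finset.sum_eq_zero]
    · grind
    · intro j hj
      simp only [Finset.pair_eq_iff]
      grind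

/-- Let `d ≥ 6` and suppose elements `v_{i,j} = v_{j,i} ∈ W` for distinct `i, j` satisfy:
(i) `σ • v_{i,j} = v_{σ(i),σ(j)}`; (ii) for each `i`, the `v_{i,j}` for `j ≠ i` span a
subspace of dimension `d - 2` and `∑_{j ≠ i} v_{i,j} = 0` is the unique nontrivial linear
relation among them; (iii) `v_{s,t} + v_{s,j} = v_{t,j}` for pairwise distinct `s, t, j`.
Then `v_{i,d} = ∑_{j ∉ {i,d}} (e_{{i,j}} + e_{{d,j}})` for every `i ≠ d`. -/
theorem stmt18 (d : ℕ) (hd : 6 ≤ d) (v : Fin d → Fin d → Wsp d)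
    (hsym : ∀ i j : Fin d, i ≠ j → v i j = v j i)
    (h1 : ∀ (σ : Equiv.Perm (Fin d)) (i j : Fin d), i ≠ j → act σ (v i j) = v (σ i) (σ j))
    (h2 : ∀ i : Fin d,
      Module.finrank (ZMod 2) ↥(Submodule.span (ZMod 2) {w | ∃ j : Fin d, j ≠ i ∧ w = v i j}) =
        d - 2)
    (h3 : ∀ i : Fin d, ∑ j ∈ Finset.univ.erase i, v i j = 0)
    (h4 : ∀ i : Fin d, ∀ T ⊆ Finset.univ.erase i,
      ∑ j ∈ T, v i j = 0 → T = ∅ ∨ T = Finset.univ.erase i)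
    (h5 : ∀ s t j : Fin d, s ≠ t → s ≠ j → t ≠ j → v s t + v s j = v t j)
    (lst : Fin d) (hlst : (lst : ℕ) = d - 1) :
    ∀ i : Fin d, i ≠ lst → v i lst = ∑ j ∈ ((Finset.univ.erase i).erase lst).attach,
      (basisVec ⟨{i, j.1},
          Finset.card_pair (Ne.symm (Finset.ne_of_mem_erase (Finset.mem_of_mem_erase j.2)))⟩ +
        basisVec ⟨{lst, j.1}, Finset.card_pair (Ne.symm (Finset.ne_of_mem_erase j.2))⟩) := by
  intro i hi
  have hσ : ∀ (σ : Equiv.Perm (Fin d)) (i j k l : Fin d), i ≠ j →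
      pairCoeff (v (σ i) (σ j)) (σ k) (σ l) = pairCoeff (v i j) k l := by
    intro σ i j k l hij
    rw [← h1 σ i j hij, pairCoeff_act]
  have hadd : ∀ s t j k l : Fin d, s ≠ t → s ≠ j → t ≠ j →
      pairCoeff (v s t) k l + pairCoeff (v s j) k l = pairCoeff (v t j) k l := by
    intro s t j k l hst hsj htj
    rw [← h5 s t j hst hsj htj, pairCoeff_add]
  have hmid : pairCoeff (v i lst) i lst = 0 := by
    obtain ⟨s, hs⟩ : ∃ s, s ∉ ({i, lst} : Finset (Fin d)) :=
      exists_notMem_of_card_lt (Finset.card_le_two.trans_lt (by omega))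
    simp only [Finset.mem_insert, Finset.mem_singleton, not_or] at hs
    have h := hσ (Equiv.swap i lst) s i i lst hs.1
    rw [Equiv.swap_apply_of_ne_of_ne hs.1 hs.2, Equiv.swap_apply_left,
      Equiv.swap_apply_right, pairCoeff_comm] at h
    rw [← hadd s i lst i lst hs.1 hs.2 hi, h]
    exact CharTwo.add_self_eq_zero _
  have hout : ∀ k l, k ≠ l → k ≠ i → k ≠ lst → l ≠ i → l ≠ lst →
      pairCoeff (v i lst) k l = 0 := by
    intro k l hkl hki hkm hli hlm
    obtain ⟨s, hs⟩ : ∃ s, s ∉ ({i, lst, k, l} : Finset (Fin d)) :=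
      exists_notMem_of_card_lt (Finset.card_le_four.trans_lt (by omega))
    simp only [Finset.mem_insert, Finset.mem_singleton, not_or] at hs
    obtain ⟨hsi, hsm, hsk, hsl⟩ := hs
    have h := hσ (Equiv.swap i lst) s i k l hsi
    rw [Equiv.swap_apply_of_ne_of_ne hsi hsm, Equiv.swap_apply_left,
      Equiv.swap_apply_of_ne_of_ne hki hkm, Equiv.swap_apply_of_ne_of_ne hli hlm] at h
    rw [← hadd s i lst k l hsi hsm hi, h]
    exact CharTwo.add_self_eq_zero _
  have hleft_eq : ∀ k l, k ≠ i → k ≠ lst → l ≠ i → l ≠ lst →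
      pairCoeff (v i lst) i k = pairCoeff (v i lst) i l := by
    intro k l hki hkm hli hlm
    have h := hσ (Equiv.swap k l) i lst i k hi
    rwa [Equiv.swap_apply_of_ne_of_ne hki.symm hli.symm,
      Equiv.swap_apply_of_ne_of_ne hkm.symm hlm.symm, Equiv.swap_apply_left, eq_comm] at h
  have hright_eq : ∀ k, k ≠ i → k ≠ lst →
      pairCoeff (v i lst) lst k = pairCoeff (v i lst) i k := by
    intro k hki hkm
    have h := hσ (Equiv.swap i lst) i lst i k hi
    rwa [Equiv.swap_apply_left, Equiv.swap_apply_right,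
      Equiv.swap_apply_of_ne_of_ne hki hkm, ← hsym i lst hi] at h
  have hne : v i lst ≠ 0 := by
    intro h
    rcases h4 i {lst} (by simp [hi.symm]) (by simpa using h) with h | h
    · simp at h
    · have := congrArg Finset.card h
      rw [Finset.card_erase_of_mem (Finset.mem_univ _), Finset.card_univ, Fintype.card_fin,
        Finset.card_singleton] at this
      omega
  have hleft : ∀ k, k ≠ i → k ≠ lst → pairCoeff (v i lst) i k = 1 := by
    intro k hki hkm
    by_contra hk
    have hk0 : pairCoeff (v i lst) i k = 0 := by
      generalize pairCoeff (v i lst) i k = c at hk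
      revert c
      decide
    refine hne (Wsp.ext_pairCoeff fun a b hab => ?_)
    have hz : pairCoeff (0 : Wsp d) a b = 0 := by simp [pairCoeff]
    have := pairCoeff_comm (v i lst) a b
    grind
  exact eq_sum_star hi hmid hout hleft fun k hki hkm =>
    (hright_eq k hki hkm).trans (hleft k hki hkm)
end
end

section
/- Let V be a submodule of (ℤ/4ℤ)³ that is free of rank 2 (i.e., isomorphic as a ℤ/4ℤ-module to (ℤ/4ℤ)²), is stable under the coordinate-permutation action of S₃, and on which S₃ acts faithfully. Then V = {(c₁, c₂, c₃) ∈ (ℤ/4ℤ)³ : c₁ + c₂ + c₃ = 0}. -/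
/-- A `2`-torsion vector of `(ℤ/4ℤ)³` other than `0` and `(2, 2, 2)` generates, together with
`(2, 2, 2)` and under coordinate permutations, the whole `2`-torsion. -/
theorem exists_eq_smul_comp_perm_add_smul (t y : Fin 3 → ZMod 4) (ht : ∀ i, 2 * t i = 0)
    (h0 : t ≠ 0) (h2 : t ≠ fun _ => 2) (hy : ∀ i, 2 * y i = 0) :
    ∃ (σ : Equiv.Perm (Fin 3)) (a b : ZMod 4), y = a • (t ∘ σ) + b • fun _ => 2 := by
  have bit : ∀ x : ZMod 4, 2 * x = 0 → ∃ b : Fin 2, x = 2 * (b.val : ZMod 4) := by decide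
  have key : ∀ p q : Fin 3 → Fin 2, p ≠ 0 → p ≠ 1 →
      ∃ (σ : Equiv.Perm (Fin 3)) (a b : Fin 2),
        ∀ i, 2 * ((q i).val : ZMod 4) =
          (a.val : ZMod 4) * (2 * ((p (σ i)).val : ZMod 4)) + (b.val : ZMod 4) * 2 := by
    decide +kernel
  choose p hp using fun i => bit (t i) (ht i)
  choose q hq using fun i => bit (y i) (hy i)
  obtain ⟨σ, a, b, h⟩ := key p q
    (fun h => h0 <| funext fun i => by simp [hp, h])
    (fun h => h2 <| funext fun i => by simp [hp, h])
  exact ⟨σ, a.val, b.val, funext fun i => by simp [hq, hp, h]⟩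

/-- A permutation-stable free submodule of rank `2` of `(ℤ/4ℤ)³` does not contain `(2, 2, 2)`. -/
theorem const_two_notMem (V : Submodule (ZMod 4) (Fin 3 → ZMod 4))
    (e : ↥V ≃ₗ[ZMod 4] (Fin 2 → ZMod 4))
    (hstable : ∀ (σ : Equiv.Perm (Fin 3)) (x : Fin 3 → ZMod 4), x ∈ V → x ∘ ⇑σ ∈ V) :
    (fun _ => 2) ∉ V := by
  intro h2
  obtain ⟨u, hu, hu0, hu2⟩ : ∃ u : Fin 2 → ZMod 4,
      (2 : ZMod 4) • u = 0 ∧ u ≠ 0 ∧ u ≠ e ⟨fun _ => 2, h2⟩ := by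
    by_cases h : ![2, 0] = e ⟨fun _ => 2, h2⟩
    · exact ⟨![0, 2], by decide, by decide, h ▸ by decide⟩
    · exact ⟨![2, 0], by decide, by decide, h⟩
  have ht : (2 : ZMod 4) • e.symm u = 0 := by rw [← map_smul, hu, map_zero]
  have hmem : ∀ y : Fin 3 → ZMod 4, (2 : ZMod 4) • y = 0 → y ∈ V := by
    intro y hy
    obtain ⟨σ, a, b, rfl⟩ := exists_eq_smul_comp_perm_add_smul (e.symm u) y
      (fun i => congrFun (congrArg Subtype.val ht) i)
      (fun h => hu0 <| by simpa using h)
      (fun h => hu2 <| by rw [← e.symm_apply_eq]; exact Subtype.ext h)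
      (fun i => congrFun hy i)
    exact V.add_mem (V.smul_mem _ (hstable σ _ (e.symm u).2)) (V.smul_mem _ h2)
  let f : {y : Fin 3 → ZMod 4 // (2 : ZMod 4) • y = 0} →
      {u : Fin 2 → ZMod 4 // (2 : ZMod 4) • u = 0} := fun y =>
    ⟨e ⟨y, hmem y y.2⟩, by
      rw [← map_smul, ← map_zero e]
      exact congrArg e (Subtype.ext y.2)⟩
  have hf : Function.Injective f := fun x y h =>
    Subtype.ext (Subtype.mk.inj (e.injective (Subtype.mk.inj h)))
  exact absurd (Fintype.card_le_of_injective f hf) (by decide +kernel)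

/-- Every vector of a permutation-stable submodule of `(ℤ/4ℤ)³` not containing `(2, 2, 2)`
has coordinate sum zero. -/
theorem sum_eq_zero_of_mem (V : Submodule (ZMod 4) (Fin 3 → ZMod 4))
    (hstable : ∀ (σ : Equiv.Perm (Fin 3)) (x : Fin 3 → ZMod 4), x ∈ V → x ∘ ⇑σ ∈ V)
    (h2 : (fun _ => 2) ∉ V) {x : Fin 3 → ZMod 4} (hx : x ∈ V) : x 0 + x 1 + x 2 = 0 := by
  by_contra hs
  have hsum : (fun _ => x 0 + x 1 + x 2) ∈ V := by
    convert V.add_mem (V.add_mem hx (hstable (finRotate 3) x hx))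
      (hstable (finRotate 3 * finRotate 3) x hx) using 1
    have r0 : finRotate 3 0 = 1 := rfl
    have r1 : finRotate 3 1 = 2 := rfl
    have r2 : finRotate 3 2 = 0 := rfl
    funext i
    fin_cases i <;> simp [r0, r1, r2] <;> ring
  have mul_two : ∀ s : ZMod 4, s ≠ 0 → ∃ a, a * s = 2 := by decide
  obtain ⟨a, ha⟩ := mul_two _ hs
  refine h2 ?_
  convert V.smul_mem a hsum using 1
  exact funext fun _ => ha.symm

/-- Let `V ⊆ (ℤ/4ℤ)³` be a submodule that is free of rank `2` (i.e. isomorphic to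
`(ℤ/4ℤ)²` as a `ℤ/4ℤ`-module), stable under the coordinate-permutation action of `S₃`,
and on which `S₃` acts faithfully.  Then
`V = {(c₁, c₂, c₃) ∈ (ℤ/4ℤ)³ : c₁ + c₂ + c₃ = 0}`. -/
theorem stmt19 (V : Submodule (ZMod 4) (Fin 3 → ZMod 4))
    (hfree : Nonempty (↥V ≃ₗ[ZMod 4] (Fin 2 → ZMod 4)))
    (hstable : ∀ (σ : Equiv.Perm (Fin 3)) (x : Fin 3 → ZMod 4), x ∈ V → x ∘ ⇑σ ∈ V)
    (hfaithful : ∀ σ : Equiv.Perm (Fin 3), (∀ x ∈ V, x ∘ ⇑σ = x) → σ = 1) :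
    ∀ c : Fin 3 → ZMod 4, c ∈ V ↔ c 0 + c 1 + c 2 = 0 := by
  obtain ⟨e⟩ := hfree
  have h2 := const_two_notMem V e hstable
  let f : V → {c : Fin 3 → ZMod 4 // c 0 + c 1 + c 2 = 0} := fun x =>
    ⟨x, sum_eq_zero_of_mem V hstable h2 x.2⟩
  have hf : Function.Injective f := fun x y h => Subtype.ext (Subtype.mk.inj h)
  have hcard : Nat.card V = Nat.card {c : Fin 3 → ZMod 4 // c 0 + c 1 + c 2 = 0} := by
    rw [Nat.card_congr e.toEquiv, Nat.card_eq_fintype_card, Nat.card_eq_fintype_card]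
    decide +kernel
  have hbij : Function.Bijective f := (Nat.bijective_iff_injective_and_card f).2 ⟨hf, hcard⟩
  refine fun c => ⟨sum_eq_zero_of_mem V hstable h2, fun hc => ?_⟩
  obtain ⟨x, hx⟩ := hbij.2 ⟨c, hc⟩
  have hxc : (x : Fin 3 → ZMod 4) = c := Subtype.mk.inj hx
  exact hxc ▸ x.2
end
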